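/- Suppose 𝓞 is a principal ideal domain (equivalently, E has class number 1). For every ε ∈ (0,1) there exists s₀ such that for every integer s ≥ s₀ the following holds: if M is an n-variable positive definite integral hermitian form over 𝓞 such that s·M is NOT represented by I_r for any positive integer r, then n ≥ (1−ε)·(ln s/k_E)², where k_E = (4+4√2)√β_E. (Equivalently, φ*_𝓞(s) ≥ (ln s/k_E)²·(1+o(1)), where φ*_𝓞(s) is the smallest n for which there exists an n-variable positive definite integral hermitian form f over 𝓞 such that s·f is not a sum of norms of linear forms over 𝓞.) -/

import Mathlib

open scoped Matrix ComplexOrder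

/-- `ω = √−ℓ` if `ℓ ≡ 1, 2 (mod 4)` and `ω = (1+√−ℓ)/2` if `ℓ ≡ 3 (mod 4)`,
realized inside `ℂ` (with `√−ℓ = √ℓ·i`). -/
noncomputable def omegaC (ℓ : ℕ) : ℂ :=
  if ℓ % 4 = 3 then (1 + Real.sqrt ℓ * Complex.I) / 2 else Real.sqrt ℓ * Complex.I

/-- The ring of integers `𝓞 = ℤ[ω] = ℤ + ℤω` of `ℚ(√−ℓ)`, as a subring of `ℂ`. -/
noncomputable def intO (ℓ : ℕ) : Subring ℂ := Subring.closure {omegaC ℓ}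

/-- `β_E = √((ℓ+1)/4)` if `ℓ ≡ 1, 2 (mod 4)` and `β_E = (ℓ+1)/(4√ℓ)` if `ℓ ≡ 3 (mod 4)`. -/
noncomputable def betaE (ℓ : ℕ) : ℝ :=
  if ℓ % 4 = 3 then ((ℓ : ℝ) + 1) / (4 * Real.sqrt ℓ) else Real.sqrt (((ℓ : ℝ) + 1) / 4)

/-- `M` (the Gram matrix of an `n`-variable hermitian form over `𝓞`) is represented by `I_r`,
i.e. the form is a sum of `r` norms of linear forms over `𝓞`. -/
def RepByNorms (ℓ n r : ℕ) (M : Matrix (Fin n) (Fin n) ℂ) : Prop :=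
  ∃ B : Matrix (Fin r) (Fin n) ℂ, (∀ i j, B i j ∈ intO ℓ) ∧ M = Bᴴ * B

section RingOfIntegers

variable {ℓ : ℕ}

lemma omegaC_mem (ℓ : ℕ) : omegaC ℓ ∈ intO ℓ := Subring.subset_closure (Set.mem_singleton _)

lemma omegaC_im_pos (hℓ : 0 < ℓ) : 0 < (omegaC ℓ).im := by
  have h : 0 < Real.sqrt ℓ := Real.sqrt_pos.2 (by exact_mod_cast hℓ)
  unfold omegaC
  split_ifs <;> simp [h]

lemma omegaC_sq (ℓ : ℕ) :
    ∃ p q : ℤ, omegaC ℓ * omegaC ℓ = p + q * omegaC ℓ := by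
  have h2 : (Real.sqrt ℓ : ℂ) * Real.sqrt ℓ = ℓ := by
    rw [← Complex.ofReal_mul, Real.mul_self_sqrt (by positivity)]; simp
  unfold omegaC
  split_ifs with h
  · obtain ⟨k, hk⟩ : ∃ k : ℕ, ℓ = 4 * k + 3 := ⟨ℓ / 4, by omega⟩
    refine ⟨-(k + 1), 1, ?_⟩
    have h3 : (ℓ : ℂ) = 4 * k + 3 := by exact_mod_cast hk
    push_cast
    linear_combination (Complex.I ^ 2 / 4) * h2 + (1 / 4 * (ℓ : ℂ)) * Complex.I_sq - 1 / 4 * h3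
  · refine ⟨-ℓ, 0, ?_⟩
    push_cast
    linear_combination (Complex.I ^ 2) * h2 + (ℓ : ℂ) * Complex.I_sq

lemma mem_intO_iff {z : ℂ} : z ∈ intO ℓ ↔ ∃ a b : ℤ, z = a + b * omegaC ℓ := by
  constructor
  · intro hz
    obtain ⟨p, q, hpq⟩ := omegaC_sq ℓ
    induction hz using Subring.closure_induction with
    | mem x hx => exact ⟨0, 1, by simpa using hx⟩
    | zero => exact ⟨0, 0, by simp⟩
    | one => exact ⟨1, 0, by simp⟩
    | add x y _ _ hx hy =>
      obtain ⟨a, b, rfl⟩ := hx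
      obtain ⟨c, d, rfl⟩ := hy
      exact ⟨a + c, b + d, by push_cast; ring⟩
    | neg x _ hx =>
      obtain ⟨a, b, rfl⟩ := hx
      exact ⟨-a, -b, by push_cast; ring⟩
    | mul x y _ _ hx hy =>
      obtain ⟨a, b, rfl⟩ := hx
      obtain ⟨c, d, rfl⟩ := hy
      refine ⟨a * c + b * d * p, a * d + b * c + b * d * q, ?_⟩
      push_cast
      linear_combination (b * d : ℂ) * hpq
  · rintro ⟨a, b, rfl⟩
    exact add_mem (intCast_mem _ a) (mul_mem (intCast_mem _ b) (omegaC_mem ℓ))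

lemma conj_omegaC_mem (ℓ : ℕ) : star (omegaC ℓ) ∈ intO ℓ := by
  rw [mem_intO_iff]
  unfold omegaC
  split_ifs with h
  · refine ⟨1, -1, ?_⟩
    simp
    ring
  · exact ⟨0, -1, by simp⟩

lemma star_mem_intO {z : ℂ} (hz : z ∈ intO ℓ) : star z ∈ intO ℓ := by
  obtain ⟨a, b, rfl⟩ := mem_intO_iff.1 hz
  rw [star_add, star_mul']
  refine add_mem ?_ (mul_mem ?_ (conj_omegaC_mem ℓ))
  · simp
  · simp

lemma intO_eq_intCast (hℓ : 0 < ℓ) {z : ℂ} (hz : z ∈ intO ℓ) (him : z.im = 0) :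
    ∃ a : ℤ, z = a := by
  obtain ⟨a, b, rfl⟩ := mem_intO_iff.1 hz
  have := (omegaC_im_pos hℓ).ne'
  have hb : (b : ℝ) = 0 := by simpa [this] using him
  have hb' : b = 0 := by exact_mod_cast hb
  exact ⟨a, by simp [hb']⟩

lemma one_le_normSq_of_mem_intO (hℓ : 0 < ℓ) {z : ℂ} (hz : z ∈ intO ℓ) (h0 : z ≠ 0) :
    1 ≤ Complex.normSq z := by
  have hmem : (Complex.normSq z : ℂ) ∈ intO ℓ := by
    rw [Complex.normSq_eq_conj_mul_self]
    exact mul_mem (star_mem_intO hz) hz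
  obtain ⟨a, ha⟩ := intO_eq_intCast hℓ hmem (by simp)
  have ha' : Complex.normSq z = a := by exact_mod_cast ha
  have hpos : 0 < Complex.normSq z := Complex.normSq_pos.2 h0
  rw [ha'] at hpos ⊢
  exact_mod_cast hpos

/-- The coefficient of `ω` of a complex number in the real basis `1, ω`. -/
noncomputable def omegaCoord (ℓ : ℕ) (z : ℂ) : ℝ := z.im / (omegaC ℓ).im

/-- The coefficient of `1` of a complex number in the real basis `1, ω`. -/
noncomputable def oneCoord (ℓ : ℕ) (z : ℂ) : ℝ := z.re - omegaCoord ℓ z * (omegaC ℓ).re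

lemma omegaCoord_sub (z w : ℂ) :
    omegaCoord ℓ (z - w) = omegaCoord ℓ z - omegaCoord ℓ w := by
  simp [omegaCoord, sub_div]

lemma oneCoord_sub (z w : ℂ) : oneCoord ℓ (z - w) = oneCoord ℓ z - oneCoord ℓ w := by
  simp [oneCoord, omegaCoord_sub]; ring

lemma omegaCoord_add_mul (hℓ : 0 < ℓ) (a b : ℝ) : omegaCoord ℓ (a + b * omegaC ℓ) = b := by
  simp [omegaCoord, (omegaC_im_pos hℓ).ne']

lemma oneCoord_add_mul (hℓ : 0 < ℓ) (a b : ℝ) : oneCoord ℓ (a + b * omegaC ℓ) = a := by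
  simp [oneCoord, omegaCoord_add_mul hℓ]

lemma coord_eq (hℓ : 0 < ℓ) (z : ℂ) : z = oneCoord ℓ z + omegaCoord ℓ z * omegaC ℓ := by
  have := (omegaC_im_pos hℓ).ne'
  apply Complex.ext <;> simp [oneCoord, omegaCoord, this]

/-- A bound for the diameter of the fundamental parallelogram spanned by `1` and `ω`. -/
noncomputable def parDiam (ℓ : ℕ) : ℝ := 1 + ‖omegaC ℓ‖

lemma one_le_parDiam (ℓ : ℕ) : 1 ≤ parDiam ℓ := by simp [parDiam]

lemma norm_le_of_coord_le (hℓ : 0 < ℓ) {z : ℂ} {r : ℝ} (h1 : |oneCoord ℓ z| ≤ r)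
    (h2 : |omegaCoord ℓ z| ≤ r) : ‖z‖ ≤ parDiam ℓ * r := by
  rw [coord_eq hℓ z]
  calc _ ≤ ‖(oneCoord ℓ z : ℂ)‖ + ‖(omegaCoord ℓ z : ℂ) * omegaC ℓ‖ := norm_add_le _ _
    _ = |oneCoord ℓ z| + |omegaCoord ℓ z| * ‖omegaC ℓ‖ := by simp
    _ ≤ r + r * ‖omegaC ℓ‖ := by gcongr
    _ = _ := by unfold parDiam; ring

lemma exists_intO_coord_mem_Ico (hℓ : 0 < ℓ) (z : ℂ) : ∃ w ∈ intO ℓ,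
    (0 ≤ oneCoord ℓ (z - w) ∧ oneCoord ℓ (z - w) < 1) ∧
      0 ≤ omegaCoord ℓ (z - w) ∧ omegaCoord ℓ (z - w) < 1 := by
  refine ⟨⌊oneCoord ℓ z⌋ + ⌊omegaCoord ℓ z⌋ * omegaC ℓ, mem_intO_iff.2 ⟨_, _, rfl⟩, ?_⟩
  have h1 := omegaCoord_add_mul hℓ ⌊oneCoord ℓ z⌋ ⌊omegaCoord ℓ z⌋
  have h2 := oneCoord_add_mul hℓ ⌊oneCoord ℓ z⌋ ⌊omegaCoord ℓ z⌋
  push_cast at h1 h2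
  rw [omegaCoord_sub, oneCoord_sub, h1, h2]
  exact ⟨⟨Int.fract_nonneg _, Int.fract_lt_one _⟩, Int.fract_nonneg _, Int.fract_lt_one _⟩

lemma exists_intO_norm_sub_le (hℓ : 0 < ℓ) (z : ℂ) : ∃ w ∈ intO ℓ, ‖z - w‖ ≤ parDiam ℓ := by
  obtain ⟨w, hw, ⟨h1, h2⟩, h3, h4⟩ := exists_intO_coord_mem_Ico hℓ z
  refine ⟨w, hw, ?_⟩
  simpa using norm_le_of_coord_le hℓ (r := 1) (abs_le.2 ⟨by linarith, h2.le⟩)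
    (abs_le.2 ⟨by linarith, h4.le⟩)

/-- An integer is a sum of `k` integers that differ by less than one from the mean. -/
lemma exists_int_equidistribution (b : ℤ) {k : ℕ} (hk : 0 < k) :
    ∃ β : Fin k → ℤ, ∑ l, β l = b ∧ ∀ l, |(β l : ℝ) - b / k| ≤ 1 := by
  have hk' : (0 : ℤ) < k := by exact_mod_cast hk
  have hkR : (0 : ℝ) < k := by exact_mod_cast hk
  have hmod := Int.emod_nonneg b hk'.ne'
  have hlt := Int.emod_lt_of_pos b hk'
  have hdiv := Int.mul_ediv_add_emod b k
  refine ⟨fun l => b / k + if (l : ℤ) < b % k then 1 else 0, ?_, fun l => ?_⟩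
  · rw [Finset.sum_add_distrib]
    obtain ⟨r, hr⟩ := Int.eq_ofNat_of_zero_le hmod
    rw [hr] at hlt hdiv ⊢
    have : ∑ l : Fin k, (if ((l : ℕ) : ℤ) < (r : ℤ) then (1 : ℤ) else 0) = r := by
      rw [Fin.sum_univ_eq_sum_range (fun l : ℕ => if (l : ℤ) < (r : ℤ) then (1 : ℤ) else 0) k,
        Finset.sum_ite, Finset.sum_const_zero, add_zero, Finset.sum_const, nsmul_eq_mul, mul_one]
      congr 1
      rw [show (Finset.range k).filter (fun l : ℕ => (l : ℤ) < (r : ℤ)) = Finset.range r by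
        ext l; simp; omega, Finset.card_range]
    rw [this]
    simp
    linarith
  · have e : (b : ℝ) / k = ((b / k : ℤ) : ℝ) + ((b % k : ℤ) : ℝ) / k := by
      have : (b : ℝ) = k * ((b / k : ℤ) : ℝ) + ((b % k : ℤ) : ℝ) := by exact_mod_cast hdiv.symm
      field_simp
      linarith
    have f1 : 0 ≤ ((b % k : ℤ) : ℝ) / k := div_nonneg (by exact_mod_cast hmod) hkR.le
    have f2 : ((b % k : ℤ) : ℝ) / k ≤ 1 := by
      rw [div_le_one hkR]; exact_mod_cast hlt.le
    rw [e, abs_le]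
    push_cast
    split_ifs <;> constructor <;> linarith

lemma exists_intO_equidistribution {b : ℂ} (hb : b ∈ intO ℓ) {k : ℕ} (hk : 0 < k) :
    ∃ β : Fin k → ℂ, (∀ l, β l ∈ intO ℓ) ∧ ∑ l, β l = b ∧ ∀ l, ‖β l‖ ≤ ‖b‖ / k + parDiam ℓ := by
  obtain ⟨p, q, rfl⟩ := mem_intO_iff.1 hb
  obtain ⟨β, hβ, hβ'⟩ := exists_int_equidistribution p hk
  obtain ⟨γ, hγ, hγ'⟩ := exists_int_equidistribution q hk
  refine ⟨fun l => β l + γ l * omegaC ℓ, fun l => mem_intO_iff.2 ⟨_, _, rfl⟩, ?_, fun l => ?_⟩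
  · rw [Finset.sum_add_distrib, ← Finset.sum_mul, ← hβ, ← hγ]
    push_cast
    rfl
  · have e : (β l + γ l * omegaC ℓ : ℂ) = (p + q * omegaC ℓ) / k +
        ((((β l : ℝ) - p / k : ℝ) : ℂ) + (((γ l : ℝ) - q / k : ℝ) : ℂ) * omegaC ℓ) := by
      push_cast; ring
    beta_reduce
    rw [e]
    refine (norm_add_le _ _).trans (add_le_add (by simp) ((norm_add_le _ _).trans ?_))
    rw [norm_mul, Complex.norm_real, Complex.norm_real]
    have := mul_le_mul_of_nonneg_right (hγ' l) (norm_nonneg (omegaC ℓ))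
    have := hβ' l
    simp only [Real.norm_eq_abs, parDiam]
    linarith

end RingOfIntegers

section Pigeonhole

variable {ℓ : ℕ}

/-- Upper unitriangular matrices. -/
structure UpperUnitri {n : ℕ} (U : Matrix (Fin n) (Fin n) ℂ) : Prop where
  diag : ∀ i, U i i = 1
  lower : ∀ i j, j < i → U i j = 0

lemma UpperUnitri.submatrix {n m : ℕ} {U : Matrix (Fin n) (Fin n) ℂ} (hU : UpperUnitri U)
    {e : Fin m → Fin n} (he : StrictMono e) : UpperUnitri (U.submatrix e e) :=
  ⟨fun _ => hU.diag _, fun _ _ h => hU.lower _ _ (he h)⟩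

/-- The translates of the fundamental parallelotope by the lattice `U 𝓞ⁿ` cover the space. -/
lemma UpperUnitri.exists_coord_mem_Ico (hℓ : 0 < ℓ) {n : ℕ} {U : Matrix (Fin n) (Fin n) ℂ}
    (hU : UpperUnitri U) (y : Fin n → ℂ) : ∃ x : Fin n → ℂ, (∀ i, x i ∈ intO ℓ) ∧ ∀ i,
      (0 ≤ oneCoord ℓ ((U *ᵥ x) i - y i) ∧ oneCoord ℓ ((U *ᵥ x) i - y i) < 1) ∧
        0 ≤ omegaCoord ℓ ((U *ᵥ x) i - y i) ∧ omegaCoord ℓ ((U *ᵥ x) i - y i) < 1 := by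
  induction n with
  | zero => exact ⟨0, fun i => i.elim0, fun i => i.elim0⟩
  | succ n ih =>
    obtain ⟨x, hx, hxy⟩ := ih (hU.submatrix Fin.strictMono_succ) (fun i => y i.succ)
    obtain ⟨w, hw, hwy⟩ := exists_intO_coord_mem_Ico hℓ (∑ j, U 0 (Fin.succ j) * x j - y 0)
    refine ⟨Fin.cons (-w) x, Fin.cases (neg_mem hw) hx, Fin.cases ?_ fun i => ?_⟩
    · have e : (U *ᵥ (Fin.cons (-w) x : Fin (n + 1) → ℂ)) 0 - y 0 =
          ∑ j, U 0 (Fin.succ j) * x j - y 0 - w := by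
        simp [Matrix.mulVec, dotProduct, Fin.sum_univ_succ, hU.diag]; ring
      rwa [e]
    · have e : (U *ᵥ (Fin.cons (-w) x : Fin (n + 1) → ℂ)) i.succ =
          (U.submatrix Fin.succ Fin.succ *ᵥ x) i := by
        simp [Matrix.mulVec, dotProduct, Fin.sum_univ_succ, hU.lower _ _ (Fin.succ_pos i)]
      rw [e]
      exact hxy i

lemma abs_sub_lt_of_floor_div_eq {a b r : ℝ} (hr : 0 < r) (ha : 0 ≤ a) (hb : 0 ≤ b)
    (h : ⌊a / r⌋₊ = ⌊b / r⌋₊) : |a - b| < r := by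
  have h1 := Nat.floor_le (div_nonneg ha hr.le)
  have h2 := Nat.lt_floor_add_one (a / r)
  have h3 := Nat.floor_le (div_nonneg hb hr.le)
  have h4 := Nat.lt_floor_add_one (b / r)
  rw [h] at h1 h2
  have : |a / r - b / r| < 1 := by rw [abs_lt]; constructor <;> linarith
  rwa [← sub_div, abs_div, abs_of_pos hr, div_lt_one hr] at this

/-- A form of Minkowski's theorem on linear forms, for unitriangular systems over `𝓞`. -/
lemma UpperUnitri.exists_norm_mulVec_le (hℓ : 0 < ℓ) {n : ℕ} {U : Matrix (Fin n) (Fin n) ℂ}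
    (hU : UpperUnitri U) {r : Fin n → ℝ} (hr : ∀ i, 0 < r i) (hprod : 2 ^ n < ∏ i, r i) :
    ∃ z : Fin n → ℂ, (∀ i, z i ∈ intO ℓ) ∧ z ≠ 0 ∧ ∀ i, ‖(U *ᵥ z) i‖ ≤ parDiam ℓ * r i := by
  obtain ⟨N, hN⟩ : ∃ N : ℕ, ∀ i, r i ≤ N := by
    obtain ⟨N, hN⟩ := exists_nat_ge (∑ i, r i)
    exact ⟨N, fun i => (Finset.single_le_sum (fun j _ => (hr j).le) (Finset.mem_univ i)).trans hN⟩
  choose x hx hxy using fun y : Fin n → Fin N × Fin N =>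
    hU.exists_coord_mem_Ico hℓ (fun i => ((y i).1 : ℝ) + ((y i).2 : ℝ) * omegaC ℓ)
  have h1 : ∀ y i, ((y i).1 : ℝ) ≤ oneCoord ℓ ((U *ᵥ x y) i) ∧
      oneCoord ℓ ((U *ᵥ x y) i) < ((y i).1 : ℝ) + 1 := by
    intro y i
    have := (hxy y i).1
    rw [oneCoord_sub, oneCoord_add_mul hℓ] at this
    constructor <;> linarith
  have h2 : ∀ y i, ((y i).2 : ℝ) ≤ omegaCoord ℓ ((U *ᵥ x y) i) ∧
      omegaCoord ℓ ((U *ᵥ x y) i) < ((y i).2 : ℝ) + 1 := by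
    intro y i
    have := (hxy y i).2
    rw [omegaCoord_sub, omegaCoord_add_mul hℓ] at this
    constructor <;> linarith
  have h1' : ∀ y i, 0 ≤ oneCoord ℓ ((U *ᵥ x y) i) := fun y i =>
    le_trans (Nat.cast_nonneg _) (h1 y i).1
  have h2' : ∀ y i, 0 ≤ omegaCoord ℓ ((U *ᵥ x y) i) := fun y i =>
    le_trans (Nat.cast_nonneg _) (h2 y i).1
  have hlt : ∀ a : Fin N, ((a : ℕ) : ℝ) + 1 ≤ N := fun a => by exact_mod_cast a.2
  let t : Fin n → Finset (ℕ × ℕ) := fun i =>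
    Finset.range (⌊N / r i⌋₊ + 1) ×ˢ Finset.range (⌊N / r i⌋₊ + 1)
  have hbin : ∀ i (a : ℝ), a ≤ N → ⌊a / r i⌋₊ < ⌊N / r i⌋₊ + 1 := fun i a ha =>
    Nat.lt_succ_of_le (Nat.floor_le_floor (div_le_div_of_nonneg_right ha (hr i).le))
  have hcard : (Fintype.piFinset t).card < (Finset.univ : Finset (Fin n → Fin N × Fin N)).card := by
    rw [Fintype.card_piFinset, Finset.card_univ, Fintype.card_fun, Fintype.card_prod,
      Fintype.card_fin, Fintype.card_fin]
    rify
    have hP : 0 < ∏ i, r i := Finset.prod_pos fun i _ => hr i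
    calc (∏ i, ((t i).card : ℝ)) ≤ ∏ i, (2 * N / r i) ^ 2 := by
          refine Finset.prod_le_prod (fun i _ => Nat.cast_nonneg _) fun i _ => ?_
          have h3 : ((⌊N / r i⌋₊ : ℝ)) ≤ N / r i :=
            Nat.floor_le (div_nonneg (Nat.cast_nonneg _) (hr i).le)
          have h4 : 1 ≤ N / r i := (one_le_div (hr i)).2 (hN i)
          simp only [t, Finset.card_product, Finset.card_range]
          push_cast
          rw [← sq, mul_div_assoc]
          gcongr
          linarith
      _ = ((2 ^ n / ∏ i, r i) * (N : ℝ) ^ n) ^ 2 := by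
          rw [Finset.prod_pow, Finset.prod_div_distrib, Finset.prod_const, Finset.card_univ,
            Fintype.card_fin, mul_pow]
          ring
      _ < (1 * (N : ℝ) ^ n) ^ 2 := by
          have hNn : 0 < (N : ℝ) ^ n := by
            rcases Nat.eq_zero_or_pos n with h | h
            · subst h; simp
            · exact pow_pos ((hr ⟨0, h⟩).trans_le (hN _)) n
          have : 2 ^ n / ∏ i, r i < 1 := (div_lt_one hP).2 hprod
          gcongr
      _ = _ := by ring
  obtain ⟨y, -, y', -, hne, heq⟩ := Finset.exists_ne_map_eq_of_card_lt_of_maps_to hcard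
    (f := fun y i => (⌊oneCoord ℓ ((U *ᵥ x y) i) / r i⌋₊, ⌊omegaCoord ℓ ((U *ᵥ x y) i) / r i⌋₊))
    (by
      intro y _
      simp only [Finset.mem_coe, Fintype.mem_piFinset, t, Finset.mem_product, Finset.mem_range]
      exact fun i => ⟨hbin i _ ((h1 y i).2.le.trans (hlt _)),
        hbin i _ ((h2 y i).2.le.trans (hlt _))⟩)
  refine ⟨x y - x y', fun i => sub_mem (hx y i) (hx y' i), fun h => hne ?_, fun i => ?_⟩
  · rw [sub_eq_zero] at h
    have key : ∀ {a b : Fin N} {c : ℝ}, ((a : ℕ) : ℝ) ≤ c → c < ((a : ℕ) : ℝ) + 1 →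
        ((b : ℕ) : ℝ) ≤ c → c < ((b : ℕ) : ℝ) + 1 → a = b := by
      intro a b c ha ha' hb hb'
      have h5 : ((a : ℕ) : ℝ) < ((b : ℕ) : ℝ) + 1 := ha.trans_lt hb'
      have h6 : ((b : ℕ) : ℝ) < ((a : ℕ) : ℝ) + 1 := hb.trans_lt ha'
      norm_cast at h5 h6
      exact Fin.ext (by omega)
    funext i
    have a1 := h1 y i
    have a2 := h2 y i
    have b1 := h1 y' i
    have b2 := h2 y' i
    rw [h] at a1 a2
    exact Prod.ext (key a1.1 a1.2 b1.1 b1.2) (key a2.1 a2.2 b2.1 b2.2)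
  · have heqi := congrFun heq i
    simp only [Prod.mk.injEq] at heqi
    rw [Matrix.mulVec_sub, Pi.sub_apply]
    refine norm_le_of_coord_le hℓ ?_ ?_
    · rw [oneCoord_sub]
      exact (abs_sub_lt_of_floor_div_eq (hr i) (h1' y i) (h1' y' i) heqi.1).le
    · rw [omegaCoord_sub]
      exact (abs_sub_lt_of_floor_div_eq (hr i) (h2' y i) (h2' y' i) heqi.2).le

end Pigeonhole

section Seysen

variable {ℓ : ℕ}

/-- The block upper triangular matrix with given diagonal blocks and upper right block. -/
def upperBlock {a b : ℕ} (A : Matrix (Fin a) (Fin a) ℂ) (B : Matrix (Fin a) (Fin b) ℂ)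
    (D : Matrix (Fin b) (Fin b) ℂ) : Matrix (Fin (a + b)) (Fin (a + b)) ℂ :=
  (Matrix.fromBlocks A B 0 D).submatrix finSumFinEquiv.symm finSumFinEquiv.symm

section upperBlock

variable {a b : ℕ} {A A' : Matrix (Fin a) (Fin a) ℂ} {B B' : Matrix (Fin a) (Fin b) ℂ}
  {D D' : Matrix (Fin b) (Fin b) ℂ}

lemma upperBlock_mul : upperBlock A B D * upperBlock A' B' D' =
    upperBlock (A * A') (A * B' + B * D') (D * D') := by
  simp [upperBlock, Matrix.submatrix_mul_equiv, Matrix.fromBlocks_multiply]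

lemma upperBlock_one : upperBlock (1 : Matrix (Fin a) (Fin a) ℂ) (0 : Matrix (Fin a) (Fin b) ℂ) 1 =
    1 := by
  simp [upperBlock, Matrix.fromBlocks_one]

lemma upperBlock_forall {P : ℂ → Prop} (hA : ∀ i j, P (A i j)) (hB : ∀ i j, P (B i j))
    (hD : ∀ i j, P (D i j)) (h0 : P 0) (i j) : P (upperBlock A B D i j) := by
  obtain ⟨i, rfl⟩ := finSumFinEquiv.surjective i
  obtain ⟨j, rfl⟩ := finSumFinEquiv.surjective j
  rcases i with i | i <;> rcases j with j | j <;> simp [upperBlock, hA, hB, hD, h0]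

lemma upperUnitri_upperBlock (hA : UpperUnitri A) (hD : UpperUnitri D) :
    UpperUnitri (upperBlock A B D) := by
  constructor
  · intro i
    obtain ⟨i, rfl⟩ := finSumFinEquiv.surjective i
    rcases i with i | i <;> simp [upperBlock, hA.diag, hD.diag]
  · intro i j hij
    obtain ⟨i, rfl⟩ := finSumFinEquiv.surjective i
    obtain ⟨j, rfl⟩ := finSumFinEquiv.surjective j
    rcases i with i | i <;> rcases j with j | j
    · simpa [upperBlock] using hA.lower i j ((Fin.strictMono_castAdd b).lt_iff_lt.1 hij)
    · simp [Fin.lt_def] at hij; omega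
    · simp [upperBlock]
    · simpa [upperBlock] using hD.lower i j (by simpa using hij)

lemma UpperUnitri.eq_upperBlock {U : Matrix (Fin (a + b)) (Fin (a + b)) ℂ} (hU : UpperUnitri U) :
    U = upperBlock (U.submatrix (Fin.castAdd b) (Fin.castAdd b))
      (U.submatrix (Fin.castAdd b) (Fin.natAdd a)) (U.submatrix (Fin.natAdd a) (Fin.natAdd a)) := by
  ext i j
  obtain ⟨i, rfl⟩ := finSumFinEquiv.surjective i
  obtain ⟨j, rfl⟩ := finSumFinEquiv.surjective j
  rcases i with i | i <;> rcases j with j | j <;> simp [upperBlock]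
  exact hU.lower _ _ (by simp [Fin.lt_def]; omega)

end upperBlock

lemma norm_mul_apply_le {m n p : ℕ} {A : Matrix (Fin m) (Fin n) ℂ} {B : Matrix (Fin n) (Fin p) ℂ}
    {α β : ℝ} (hα : 0 ≤ α) (hA : ∀ i j, ‖A i j‖ ≤ α) (hB : ∀ i j, ‖B i j‖ ≤ β) (i j) :
    ‖(A * B) i j‖ ≤ n * (α * β) := by
  rw [Matrix.mul_apply]
  refine (norm_sum_le _ _).trans ?_
  refine (Finset.sum_le_card_nsmul _ _ (α * β) fun k _ => ?_).trans (by simp)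
  rw [norm_mul]
  exact mul_le_mul (hA _ _) (hB _ _) (norm_nonneg _) hα

lemma mul_apply_mem_intO {m n p : ℕ} {A : Matrix (Fin m) (Fin n) ℂ} {B : Matrix (Fin n) (Fin p) ℂ}
    (hA : ∀ i j, A i j ∈ intO ℓ) (hB : ∀ i j, B i j ∈ intO ℓ) (i j) : (A * B) i j ∈ intO ℓ := by
  rw [Matrix.mul_apply]
  exact sum_mem fun k _ => mul_mem (hA _ _) (hB _ _)

lemma one_apply_mem_intO {n : ℕ} (i j : Fin n) :
    (1 : Matrix (Fin n) (Fin n) ℂ) i j ∈ intO ℓ := by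
  rw [Matrix.one_apply]
  split_ifs
  exacts [one_mem _, zero_mem _]

/-- Seysen's simultaneous reduction: a unitriangular matrix may be multiplied by an integral
unimodular one so that the product and its inverse both have quasi-polynomially bounded entries. -/
lemma UpperUnitri.exists_seysen_reduction (hℓ : 0 < ℓ) {N : ℕ} (hN : 1 ≤ N) (K : ℕ) :
    ∀ {n : ℕ}, n ≤ 2 ^ K → n ≤ N → ∀ {U : Matrix (Fin n) (Fin n) ℂ}, UpperUnitri U →
      ∃ G G' V : Matrix (Fin n) (Fin n) ℂ, (∀ i j, G i j ∈ intO ℓ) ∧ (∀ i j, G' i j ∈ intO ℓ) ∧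
        G * G' = 1 ∧ UpperUnitri (U * G) ∧ UpperUnitri V ∧ V * (U * G) = 1 ∧
        (∀ i j, ‖(U * G) i j‖ ≤ (parDiam ℓ * N) ^ K) ∧ ∀ i j, ‖V i j‖ ≤ (parDiam ℓ * N) ^ K := by
  have hc := one_le_parDiam ℓ
  have hNR : (1 : ℝ) ≤ N := by exact_mod_cast hN
  have hB : 1 ≤ parDiam ℓ * N := one_le_mul_of_one_le_of_one_le hc hNR
  induction K with
  | zero =>
    intro n hn _ U hU
    have hU1 : U = 1 := by
      ext i j
      have hij : i = j := Fin.ext (by have := i.2; have := j.2; simp at hn; omega)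
      subst hij
      simp [hU.diag]
    have h1 : ∀ i j : Fin n, ‖(1 : Matrix (Fin n) (Fin n) ℂ) i j‖ ≤ (parDiam ℓ * N) ^ 0 := by
      intro i j
      rw [Matrix.one_apply]
      split_ifs <;> simp
    exact ⟨1, 1, 1, one_apply_mem_intO, one_apply_mem_intO, by simp, by simpa using hU,
      hU1 ▸ hU, by simp [hU1], by simpa [hU1] using h1, h1⟩
  | succ K ih =>
    intro n hn hnN U hU
    obtain ⟨a, b, rfl, ha, hb⟩ : ∃ a b, n = a + b ∧ a ≤ 2 ^ K ∧ b ≤ 2 ^ K := by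
      rw [pow_succ] at hn
      exact ⟨n / 2, n - n / 2, by omega, by omega, by omega⟩
    obtain ⟨G₁, G₁', V₁, hG₁, hG₁', hGG₁, hW₁, hV₁, hVW₁, hWb₁, hVb₁⟩ :=
      ih ha (by omega) (hU.submatrix (Fin.strictMono_castAdd b))
    obtain ⟨G₂, G₂', V₂, hG₂, hG₂', hGG₂, hW₂, hV₂, hVW₂, hWb₂, hVb₂⟩ :=
      ih hb (by omega) (hU.submatrix (Fin.strictMono_natAdd a))
    have hUe := hU.eq_upperBlock
    set U₁ := U.submatrix (Fin.castAdd b) (Fin.castAdd b)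
    set X := U.submatrix (Fin.castAdd b) (Fin.natAdd a)
    set U₂ := U.submatrix (Fin.natAdd a) (Fin.natAdd a)
    choose Z' hZ hΦ using fun i j => exists_intO_norm_sub_le hℓ ((V₁ * (X * G₂)) i j)
    set Z : Matrix (Fin a) (Fin b) ℂ := Matrix.of Z'
    set Φ : Matrix (Fin a) (Fin b) ℂ := V₁ * (X * G₂) - Z
    have hWV₁ : U₁ * G₁ * V₁ = 1 := mul_eq_one_comm.1 hVW₁
    have hX : U₁ * (-(G₁ * Z)) + X * G₂ = U₁ * G₁ * Φ := by
      simp only [Φ, Matrix.mul_sub, ← Matrix.mul_assoc, hWV₁, Matrix.one_mul, Matrix.mul_neg]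
      abel
    have hUG : U * upperBlock G₁ (-(G₁ * Z)) G₂ =
        upperBlock (U₁ * G₁) (U₁ * G₁ * Φ) (U₂ * G₂) := by
      rw [hUe, upperBlock_mul, hX]
    have hpow : (parDiam ℓ * N) ^ K ≤ (parDiam ℓ * N) ^ (K + 1) :=
      pow_le_pow_right₀ hB (Nat.le_succ K)
    have hpos : 0 ≤ (parDiam ℓ * N) ^ K := by positivity
    have hle : ∀ m : ℕ, m ≤ N →
        (m : ℝ) * ((parDiam ℓ * N) ^ K * parDiam ℓ) ≤ (parDiam ℓ * N) ^ (K + 1) := by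
      intro m hm
      have hm' : (m : ℝ) ≤ N := by exact_mod_cast hm
      calc _ ≤ (N : ℝ) * ((parDiam ℓ * N) ^ K * parDiam ℓ) := by gcongr
        _ = _ := by ring
    refine ⟨upperBlock G₁ (-(G₁ * Z)) G₂, upperBlock G₁' (Z * G₂') G₂',
      upperBlock V₁ (-(Φ * V₂)) V₂, ?_, ?_, ?_, ?_, ?_, ?_, ?_, ?_⟩
    · exact upperBlock_forall hG₁ (fun i j => neg_mem (mul_apply_mem_intO hG₁ hZ i j)) hG₂
        (zero_mem _)
    · exact upperBlock_forall hG₁' (mul_apply_mem_intO hZ hG₂') hG₂' (zero_mem _)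
    · rw [upperBlock_mul, hGG₁, hGG₂, Matrix.neg_mul, Matrix.mul_assoc, add_neg_cancel,
        upperBlock_one]
    · rw [hUG]
      exact upperUnitri_upperBlock hW₁ hW₂
    · exact upperUnitri_upperBlock hV₁ hV₂
    · rw [hUG, upperBlock_mul, hVW₁, hVW₂, Matrix.neg_mul, Matrix.mul_assoc Φ, hVW₂,
        ← Matrix.mul_assoc, hVW₁, Matrix.one_mul, Matrix.mul_one, add_neg_cancel, upperBlock_one]
    · rw [hUG]
      refine upperBlock_forall (P := fun z => ‖z‖ ≤ (parDiam ℓ * N) ^ (K + 1))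
        (fun i j => (hWb₁ i j).trans hpow)
        (fun i j => (norm_mul_apply_le hpos hWb₁ hΦ i j).trans (hle a (by omega)))
        (fun i j => (hWb₂ i j).trans hpow) ?_
      rw [norm_zero]
      exact hpos.trans hpow
    · refine upperBlock_forall (P := fun z => ‖z‖ ≤ (parDiam ℓ * N) ^ (K + 1))
        (fun i j => (hVb₁ i j).trans hpow) (fun i j => ?_)
        (fun i j => (hVb₂ i j).trans hpow) ?_
      · rw [Matrix.neg_apply, norm_neg]
        refine (norm_mul_apply_le (by linarith) hΦ hVb₂ i j).trans ?_
        rw [mul_comm (parDiam ℓ)]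
        exact hle b (by omega)
      · rw [norm_zero]
        exact hpos.trans hpow

end Seysen

section SumsOfNorms

variable {ℓ n : ℕ}

/-- The additive monoid of hermitian matrices that are sums of norms of linear forms. -/
def sumsOfNorms (ℓ n : ℕ) : AddSubmonoid (Matrix (Fin n) (Fin n) ℂ) where
  carrier := {M | ∃ r, RepByNorms ℓ n r M}
  zero_mem' := ⟨0, 0, fun i => i.elim0, by ext; simp [Matrix.mul_apply]⟩
  add_mem' := by
    rintro _ _ ⟨r, B, hB, rfl⟩ ⟨r', B', hB', rfl⟩
    refine ⟨r + r', Matrix.of fun i j => Fin.append (fun i => B i j) (fun i => B' i j) i,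
      fun i j => ?_, ?_⟩
    · refine Fin.addCases (fun i => ?_) (fun i => ?_) i <;> simp [hB, hB']
    · ext i j
      simp [Matrix.mul_apply, Fin.sum_univ_add]

lemma exists_pos_rep_of_mem_sumsOfNorms {M : Matrix (Fin n) (Fin n) ℂ}
    (hM : M ∈ sumsOfNorms ℓ n) : ∃ r, 0 < r ∧ RepByNorms ℓ n r M := by
  obtain ⟨r, B, hB, rfl⟩ := hM
  refine ⟨r + 1, r.succ_pos,
    Matrix.of fun i j => (Fin.cons 0 (fun i => B i j) : Fin (r + 1) → ℂ) i, fun i j => ?_, ?_⟩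
  · refine Fin.cases ?_ (fun i => ?_) i <;> simp [hB, zero_mem]
  · ext i j
    simp [Matrix.mul_apply, Fin.sum_univ_succ]

lemma conjTranspose_mul_self_mem_sumsOfNorms {r : ℕ} {B : Matrix (Fin r) (Fin n) ℂ}
    (hB : ∀ i j, B i j ∈ intO ℓ) : Bᴴ * B ∈ sumsOfNorms ℓ n := ⟨r, B, hB, rfl⟩

lemma conj_mem_sumsOfNorms {M : Matrix (Fin n) (Fin n) ℂ} (hM : M ∈ sumsOfNorms ℓ n)
    {G : Matrix (Fin n) (Fin n) ℂ} (hG : ∀ i j, G i j ∈ intO ℓ) :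
    Gᴴ * M * G ∈ sumsOfNorms ℓ n := by
  obtain ⟨r, B, hB, rfl⟩ := hM
  refine ⟨r, B * G, mul_apply_mem_intO hB hG, ?_⟩
  rw [Matrix.conjTranspose_mul]
  simp only [Matrix.mul_assoc]

lemma Matrix.IsHermitian.im_apply_self_eq_zero {A : Matrix (Fin n) (Fin n) ℂ} (hA : A.IsHermitian)
    (i : Fin n) : (A i i).im = 0 := by
  have h := congrArg Complex.im (hA.apply i i)
  simp at h
  linarith

lemma isHermitian_of_mem_sumsOfNorms {M : Matrix (Fin n) (Fin n) ℂ}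
    (hM : M ∈ sumsOfNorms ℓ n) : M.IsHermitian := by
  obtain ⟨r, B, -, rfl⟩ := hM
  exact Matrix.isHermitian_conjTranspose_mul_self B

lemma apply_mem_intO_of_mem_sumsOfNorms {M : Matrix (Fin n) (Fin n) ℂ}
    (hM : M ∈ sumsOfNorms ℓ n) (i j) : M i j ∈ intO ℓ := by
  obtain ⟨r, B, hB, rfl⟩ := hM
  exact mul_apply_mem_intO (fun i j => star_mem_intO (hB j i)) hB i j

lemma diagonal_mem_sumsOfNorms (d : Fin n → ℕ) :
    Matrix.diagonal (fun i => (d i : ℂ)) ∈ sumsOfNorms ℓ n := by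
  have hone : ∀ i, Matrix.single i i (1 : ℂ) ∈ sumsOfNorms ℓ n := by
    intro i
    have : (Matrix.single i i (1 : ℂ))ᴴ * Matrix.single i i 1 ∈ sumsOfNorms ℓ n := by
      refine conjTranspose_mul_self_mem_sumsOfNorms fun a b => ?_
      rw [Matrix.single_apply]
      split_ifs
      exacts [one_mem _, zero_mem _]
    simpa using this
  have : Matrix.diagonal (fun i => (d i : ℂ)) = ∑ i, d i • Matrix.single i i (1 : ℂ) := by
    ext a b
    rw [Matrix.sum_apply]
    simp [Matrix.single_apply, Matrix.diagonal_apply, ite_and]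
  rw [this]
  exact sum_mem fun i _ => nsmul_mem (hone i) _

/-- The hermitian matrix supported on the rows and columns `i, j`. -/
def pairMatrix (i j : Fin n) (x y : ℝ) (b : ℂ) : Matrix (Fin n) (Fin n) ℂ :=
  Matrix.single i i (x : ℂ) + Matrix.single j j (y : ℂ) + Matrix.single i j b +
    Matrix.single j i (star b)

lemma pairMatrix_swap (i j : Fin n) (x y : ℝ) (b : ℂ) :
    pairMatrix i j x y b = pairMatrix j i y x (star b) := by
  simp only [pairMatrix, star_star]
  abel

lemma exists_pairMatrix_mem (i j : Fin n) (hij : i ≠ j) {b : ℂ} (hb : b ∈ intO ℓ) {k : ℕ}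
    (hk : 0 < k) : ∃ y : ℝ, y ≤ k * (‖b‖ / k + parDiam ℓ) ^ 2 ∧
      pairMatrix i j k y b ∈ sumsOfNorms ℓ n := by
  obtain ⟨β, hβ, hsum, hle⟩ := exists_intO_equidistribution hb hk
  refine ⟨∑ l, ‖β l‖ ^ 2, ?_, ?_⟩
  · refine (Finset.sum_le_card_nsmul _ _ ((‖b‖ / k + parDiam ℓ) ^ 2) fun l _ => ?_).trans (by simp)
    have := hle l
    gcongr
  · let B : Matrix (Fin k) (Fin n) ℂ := Matrix.of fun l => Pi.single i 1 + Pi.single j (β l)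
    have hB : ∀ l a, B l a ∈ intO ℓ := by
      intro l a
      simp only [B, Matrix.of_apply, Pi.add_apply, Pi.single_apply]
      refine add_mem ?_ ?_ <;> split_ifs
      exacts [one_mem _, zero_mem _, hβ l, zero_mem _]
    have h := conjTranspose_mul_self_mem_sumsOfNorms hB
    have e : Bᴴ * B = pairMatrix i j k (∑ l, ‖β l‖ ^ 2) b := by
      have hn : ∀ l, star (β l) * β l = (‖β l‖ : ℂ) ^ 2 := fun l => Complex.conj_mul' (β l)
      ext p q
      simp only [B, pairMatrix, Matrix.mul_apply, Matrix.conjTranspose_apply, Matrix.of_apply,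
        Matrix.add_apply, Pi.add_apply, Pi.single_apply, Matrix.single_apply, ← hsum]
      by_cases hpi : p = i <;> by_cases hpj : p = j <;> by_cases hqi : q = i <;>
        by_cases hqj : q = j <;> simp_all [eq_comm]
    rwa [e] at h

lemma exists_pairMatrix_mem_of_norm_le (i j : Fin n) (hij : i ≠ j) {b : ℂ} (hb : b ∈ intO ℓ)
    {E u v : ℕ} (hE : 0 < E) (hu : 0 < u) (huv : u ≤ v) (hbE : ‖b‖ ^ 2 ≤ E ^ 2 * (u * v)) :
    ∃ x y : ℝ, x ≤ 4 * parDiam ℓ ^ 2 * E * u ∧ y ≤ 4 * parDiam ℓ ^ 2 * E * v ∧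
      pairMatrix i j x y b ∈ sumsOfNorms ℓ n := by
  obtain ⟨y, hy, hmem⟩ := exists_pairMatrix_mem i j hij hb (Nat.mul_pos hE hu)
  have hc := one_le_parDiam ℓ
  have hc2 : 1 ≤ parDiam ℓ ^ 2 := one_le_pow₀ hc
  have hER : (0 : ℝ) < E := by exact_mod_cast hE
  have huR : (0 : ℝ) < u := by exact_mod_cast hu
  have huvR : (u : ℝ) ≤ v := by exact_mod_cast huv
  have hEu : 0 < (E * u : ℝ) := mul_pos hER huR
  refine ⟨_, y, ?_, hy.trans ?_, hmem⟩
  · push_cast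
    nlinarith
  · push_cast
    have h1 : ‖b‖ ^ 2 / (E * u) ≤ E * v := by
      rw [div_le_iff₀ hEu]; linarith
    have h2 : (E * u : ℝ) * (‖b‖ / (E * u) + parDiam ℓ) ^ 2 ≤
        2 * (‖b‖ ^ 2 / (E * u)) + 2 * parDiam ℓ ^ 2 * (E * u) := by
      have : 2 * (‖b‖ ^ 2 / (E * u)) = (E * u : ℝ) * (2 * (‖b‖ / (E * u)) ^ 2) := by
        field_simp
      rw [this]
      nlinarith [mul_nonneg hEu.le (sq_nonneg (‖b‖ / (E * u) - parDiam ℓ))]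
    have h3 : (E * u : ℝ) ≤ E * v := by gcongr
    have h4 : (E * v : ℝ) ≤ parDiam ℓ ^ 2 * (E * v) := le_mul_of_one_le_left (by positivity) hc2
    have h5 : parDiam ℓ ^ 2 * (E * u : ℝ) ≤ parDiam ℓ ^ 2 * (E * v) := by gcongr
    linarith

/-- A diagonally dominant integral hermitian matrix is a sum of norms; the dominance is measured
with respect to weights `μ`. -/
lemma mem_sumsOfNorms_of_dominant (hℓ : 0 < ℓ) {R : Matrix (Fin n) (Fin n) ℂ}
    (hR : ∀ i j, R i j ∈ intO ℓ) (hRh : R.IsHermitian) {μ : Fin n → ℕ} (hμ : ∀ i, 0 < μ i)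
    {E : ℕ} (hE : 0 < E) (hoff : ∀ i j, i ≠ j → ‖R i j‖ ^ 2 ≤ E ^ 2 * (μ i * μ j))
    (hdiag : ∀ i, 8 * n * parDiam ℓ ^ 2 * E * μ i ≤ (R i i).re) : R ∈ sumsOfNorms ℓ n := by
  have hpair : ∀ i j, ∃ x y : ℝ, i ≠ j → x ≤ 4 * parDiam ℓ ^ 2 * E * μ i ∧
      y ≤ 4 * parDiam ℓ ^ 2 * E * μ j ∧ pairMatrix i j x y (R i j) ∈ sumsOfNorms ℓ n := by
    intro i j
    by_cases hij : i = j
    · exact ⟨0, 0, fun h => absurd hij h⟩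
    rcases le_total (μ i) (μ j) with h | h
    · obtain ⟨x, y, h'⟩ := exists_pairMatrix_mem_of_norm_le i j hij (hR i j) hE (hμ i) h
        (hoff i j hij)
      exact ⟨x, y, fun _ => h'⟩
    · obtain ⟨y, x, hy, hx, hm⟩ := exists_pairMatrix_mem_of_norm_le j i (Ne.symm hij) (hR j i) hE
        (hμ j) h (hoff j i (Ne.symm hij))
      rw [pairMatrix_swap, hRh.apply i j] at hm
      exact ⟨x, y, fun _ => ⟨hx, hy, hm⟩⟩
  choose x y hxy using hpair
  set P : Matrix (Fin n) (Fin n) ℂ :=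
    ∑ i, ∑ j, if i < j then pairMatrix i j (x i j) (y i j) (R i j) else 0
  have hP : P ∈ sumsOfNorms ℓ n := by
    refine sum_mem fun i _ => sum_mem fun j _ => ?_
    split_ifs with h
    exacts [(hxy i j h.ne).2.2, zero_mem _]
  have hPapp : ∀ p q, P p q = ∑ i, ∑ j,
      if i < j then pairMatrix i j (x i j) (y i j) (R i j) p q else 0 := by
    intro p q
    simp only [P, Matrix.sum_apply]
    refine Finset.sum_congr rfl fun i _ => Finset.sum_congr rfl fun j _ => ?_
    split_ifs <;> rfl
  have hPh := isHermitian_of_mem_sumsOfNorms hP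
  have hPoff : ∀ p q, p < q → P p q = R p q := by
    intro p q hpq
    rw [hPapp, Finset.sum_eq_single p, Finset.sum_eq_single q]
    · simp [hpq, pairMatrix, hpq.ne, hpq.ne']
    · intro j _ hj
      split_ifs
      · simp [pairMatrix, hpq.ne, hj]
      · rfl
    · simp
    · intro i _ hi
      refine Finset.sum_eq_zero fun j _ => ?_
      split_ifs with h
      · simp [pairMatrix, Matrix.single_apply, hi]
        rw [if_neg (by rintro ⟨rfl, rfl⟩; exact hpq.ne rfl),
          if_neg (by rintro ⟨rfl, rfl⟩; exact h.not_gt hpq), add_zero]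
      · rfl
    · simp
  have hPdiag : ∀ p, (P p p).re ≤ 8 * n * parDiam ℓ ^ 2 * E * μ p := by
    intro p
    have hT : 0 ≤ 4 * parDiam ℓ ^ 2 * E * μ p := by positivity
    rw [hPapp, Complex.re_sum]
    calc _ ≤ ∑ i, ∑ j, ((if i = p then 4 * parDiam ℓ ^ 2 * E * μ p else 0) +
          (if j = p then 4 * parDiam ℓ ^ 2 * E * μ p else 0)) := by
          refine Finset.sum_le_sum fun i _ => ?_
          rw [Complex.re_sum]
          refine Finset.sum_le_sum fun j _ => ?_
          by_cases h : i < j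
          · have h' := hxy i j h.ne
            rw [if_pos h]
            by_cases hi : i = p
            · subst hi
              simpa [pairMatrix, Matrix.single_apply, h.ne, h.ne'] using h'.1
            · by_cases hj : j = p
              · subst hj
                simpa [pairMatrix, Matrix.single_apply, h.ne, h.ne'] using h'.2.1
              · simp [pairMatrix, hi, hj]
          · rw [if_neg h, Complex.zero_re]
            split_ifs <;> linarith
      _ = _ := by
          simp [Finset.sum_add_distrib]
          ring
  have hd : ∀ i, ∃ d : ℕ, R i i - P i i = d := by
    intro i
    obtain ⟨a, ha⟩ := intO_eq_intCast hℓ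
      (sub_mem (hR i i) (apply_mem_intO_of_mem_sumsOfNorms hP i i))
      (by simp [hRh.im_apply_self_eq_zero, hPh.im_apply_self_eq_zero])
    have h0 : (0 : ℝ) ≤ a := by
      have h := congrArg Complex.re ha
      simp at h
      linarith [hPdiag i, hdiag i]
    obtain ⟨d, rfl⟩ := Int.eq_ofNat_of_zero_le (by exact_mod_cast h0 : 0 ≤ a)
    exact ⟨d, by simpa using ha⟩
  choose d hd using hd
  have e : R = P + Matrix.diagonal (fun i => (d i : ℂ)) := by
    ext p q
    rcases lt_trichotomy p q with h | rfl | h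
    · simp [h.ne, hPoff p q h]
    · simp [← hd p]
    · simp only [Matrix.add_apply, Matrix.diagonal_apply, h.ne', if_false, add_zero]
      rw [← hPh.apply, hPoff q p h, hRh.apply]
  rw [e]
  exact add_mem hP (diagonal_mem_sumsOfNorms d)

end SumsOfNorms

section Rounding

variable {ℓ n : ℕ}

/-- Rounding a square root of an integral hermitian matrix that dominates a diagonal matrix. -/
lemma nsmul_mem_sumsOfNorms_of_dominates (hℓ : 0 < ℓ) {M : Matrix (Fin n) (Fin n) ℂ}
    (hM : ∀ i j, M i j ∈ intO ℓ) (hMh : M.IsHermitian) {μ : Fin n → ℕ} (hμ : ∀ i, 0 < μ i)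
    (hdiag : ∀ i, M i i = μ i) {X : ℝ} (hX : 1 ≤ X)
    (hdom : ∀ x : Fin n → ℂ, ∑ i, μ i * Complex.normSq (x i) ≤ X * (star x ⬝ᵥ M *ᵥ x).re)
    {s : ℕ} (hs : (36 * parDiam ℓ ^ 4 * X) ^ 2 * n ^ 3 ≤ s) :
    (s : ℂ) • M ∈ sumsOfNorms ℓ n := by
  rcases Nat.eq_zero_or_pos n with rfl | hn
  · rw [Subsingleton.elim ((s : ℂ) • M) 0]
    exact zero_mem _
  set c := parDiam ℓ
  have hc : 1 ≤ c := one_le_parDiam ℓ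
  have hnR : (1 : ℝ) ≤ n := by exact_mod_cast hn
  have hX0 : 0 < X := by linarith
  set D : Matrix (Fin n) (Fin n) ℂ := Matrix.diagonal fun i => ((s * μ i / X : ℝ) : ℂ)
  have hDoff : ∀ i j, i ≠ j → D i j = 0 := fun i j h => Matrix.diagonal_apply_ne _ h
  have hDdiag : ∀ i, D i i = ((s * μ i / X : ℝ) : ℂ) := fun i => Matrix.diagonal_apply_eq _ i
  have hDh : D.IsHermitian := by
    ext i j
    by_cases h : i = j
    · subst h; simp [D]
    · simp [D, h, Ne.symm h]
  have hK : (((s : ℂ) • M) - D).PosSemidef := by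
    have hKh : (((s : ℂ) • M) - D).IsHermitian := by
      refine Matrix.IsHermitian.sub ?_ hDh
      ext i j
      simp [hMh.apply]
    refine Matrix.PosSemidef.of_dotProduct_mulVec_nonneg hKh fun x => ?_
    have him := hKh.im_star_dotProduct_mulVec_self x
    rw [Complex.nonneg_iff]
    refine ⟨?_, him.symm⟩
    have hD : (star x ⬝ᵥ D *ᵥ x).re = s / X * ∑ i, μ i * Complex.normSq (x i) := by
      simp only [dotProduct, D, Matrix.mulVec_diagonal, Complex.re_sum, Finset.mul_sum]
      refine Finset.sum_congr rfl fun i _ => ?_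
      simp [Complex.normSq_apply]
      ring
    rw [Matrix.sub_mulVec, dotProduct_sub, Matrix.smul_mulVec, dotProduct_smul, Complex.sub_re, hD]
    have h := mul_le_mul_of_nonneg_left (hdom x) (show (0 : ℝ) ≤ s / X by positivity)
    have e : (s : ℝ) / X * (X * (star x ⬝ᵥ M *ᵥ x).re) = s * (star x ⬝ᵥ M *ᵥ x).re := by
      field_simp
    rw [e] at h
    simpa using h
  obtain ⟨A, hA⟩ : ∃ A : Matrix (Fin n) (Fin n) ℂ, (s : ℂ) • M - D = Aᴴ * A := by
    open scoped MatrixOrder in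
    exact CStarAlgebra.nonneg_iff_eq_star_mul_self.1 hK.nonneg
  choose B hB hF using fun i j => exists_intO_norm_sub_le hℓ (A i j)
  set B' : Matrix (Fin n) (Fin n) ℂ := B
  set F : Matrix (Fin n) (Fin n) ℂ := A - B'
  have hF' : ∀ i j, ‖F i j‖ ≤ c := hF
  set R : Matrix (Fin n) (Fin n) ℂ := (s : ℂ) • M - B'ᴴ * B'
  have hBB := conjTranspose_mul_self_mem_sumsOfNorms (ℓ := ℓ) (B := B') hB
  have hRe : R = D + (Aᴴ * F + Fᴴ * A - Fᴴ * F) := by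
    have h1 : (s : ℂ) • M = Aᴴ * A + D := by rw [← hA]; abel
    have h2 : B' = A - F := by simp [F]
    simp only [R, h1, h2, Matrix.conjTranspose_sub]
    noncomm_ring
  set w : Fin n → ℝ := fun i => Real.sqrt (μ i)
  have hw1 : ∀ i, 1 ≤ w i := fun i => Real.one_le_sqrt.2 (by exact_mod_cast hμ i)
  have hw2 : ∀ i, w i ^ 2 = μ i := fun i => Real.sq_sqrt (by positivity)
  set T : ℝ := Real.sqrt (n * s)
  have hT2 : T ^ 2 = n * s := Real.sq_sqrt (by positivity)
  have hTn : n ≤ T := Real.le_sqrt_of_sq_le (by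
    have h3 : (n : ℝ) ≤ s := by
      refine le_trans ?_ hs
      have h4 : 1 ≤ 36 * c ^ 4 * X := by
        have : 1 ≤ c ^ 4 := one_le_pow₀ hc
        nlinarith
      have h5 : (1 : ℝ) ≤ (36 * c ^ 4 * X) ^ 2 := one_le_pow₀ h4
      have h6 : (n : ℝ) ≤ n ^ 3 := le_self_pow₀ hnR (by norm_num)
      calc (n : ℝ) ≤ n ^ 3 := h6
        _ ≤ _ := le_mul_of_one_le_left (by positivity) h5
    nlinarith)
  have ha : ∀ i, ∑ k, ‖A k i‖ ≤ T * w i := by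
    intro i
    have h1 : ∑ k, ‖A k i‖ ^ 2 ≤ s * μ i := by
      have h := congrArg Complex.re (congrFun (congrFun hA i) i)
      have e : ((Aᴴ * A) i i).re = ∑ k, ‖A k i‖ ^ 2 := by
        rw [Matrix.mul_apply, Complex.re_sum]
        refine Finset.sum_congr rfl fun k _ => ?_
        rw [← Complex.normSq_eq_norm_sq, Complex.normSq_apply]
        simp
      rw [e] at h
      rw [← h]
      simp [hdiag, D]
      positivity
    have h2 : (∑ k, ‖A k i‖) ^ 2 ≤ n * ∑ k, ‖A k i‖ ^ 2 := by
      simpa using sq_sum_le_card_mul_sum_sq (s := Finset.univ) (f := fun k => ‖A k i‖)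
    have h3 : (∑ k, ‖A k i‖) ^ 2 ≤ (T * w i) ^ 2 := by
      rw [mul_pow, hT2, hw2]
      calc _ ≤ _ := h2
        _ ≤ n * (s * μ i) := by gcongr
        _ = _ := by ring
    exact le_of_sq_le_sq h3 (by have := hw1 i; positivity)
  have hent : ∀ i j, ‖(Aᴴ * F + Fᴴ * A - Fᴴ * F) i j‖ ≤ 3 * c ^ 2 * T * (w i * w j) := by
    intro i j
    have h1 : ‖(Aᴴ * F) i j‖ ≤ T * w i * c := by
      rw [Matrix.mul_apply]
      calc _ ≤ ∑ k, ‖A k i‖ * c := norm_sum_le_of_le _ fun k _ => by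
            simpa using mul_le_mul_of_nonneg_left (hF' k j) (norm_nonneg (A k i))
        _ = (∑ k, ‖A k i‖) * c := by rw [Finset.sum_mul]
        _ ≤ _ := by gcongr; exact ha i
    have h2 : ‖(Fᴴ * A) i j‖ ≤ T * w j * c := by
      rw [Matrix.mul_apply]
      calc _ ≤ ∑ k, ‖A k j‖ * c := norm_sum_le_of_le _ fun k _ => by
            rw [mul_comm]
            simpa using mul_le_mul_of_nonneg_left (hF' k i) (norm_nonneg (A k j))
        _ = (∑ k, ‖A k j‖) * c := by rw [Finset.sum_mul]
        _ ≤ _ := by gcongr; exact ha j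
    have h3 : ‖(Fᴴ * F) i j‖ ≤ n * c ^ 2 := by
      rw [Matrix.mul_apply]
      calc _ ≤ ∑ k : Fin n, c ^ 2 := norm_sum_le_of_le _ fun k _ => by
            have := mul_le_mul (hF' k i) (hF' k j) (norm_nonneg _) (by linarith)
            rw [← sq] at this
            simpa using this
        _ = _ := by simp
    have hwi := hw1 i
    have hwj := hw1 j
    have hT0 : 0 ≤ T := Real.sqrt_nonneg _
    have hcc : c ≤ c ^ 2 := le_self_pow₀ hc (by norm_num)
    have hi : w i ≤ w i * w j := le_mul_of_one_le_right (by linarith) hwj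
    have hj : w j ≤ w i * w j := le_mul_of_one_le_left (by linarith) hwi
    have h11 : (1 : ℝ) ≤ w i * w j := hwi.trans hi
    calc _ ≤ ‖(Aᴴ * F) i j‖ + ‖(Fᴴ * A) i j‖ + ‖(Fᴴ * F) i j‖ :=
          (norm_sub_le _ _).trans (add_le_add_left (norm_add_le _ _) _)
      _ ≤ T * (w i * w j) * c ^ 2 + T * (w i * w j) * c ^ 2 + T * c ^ 2 * (w i * w j) := by
          refine add_le_add (add_le_add (h1.trans ?_) (h2.trans ?_)) (h3.trans ?_)
          · gcongr
          · gcongr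
          · calc n * c ^ 2 ≤ T * c ^ 2 := by gcongr
              _ ≤ _ := le_mul_of_one_le_right (by positivity) h11
      _ = _ := by ring
  have hT1 : 1 ≤ T := hnR.trans hTn
  have hc2 : 1 ≤ c ^ 2 := one_le_pow₀ hc
  set E := ⌈3 * c ^ 2 * T⌉₊
  have hE1 : 3 * c ^ 2 * T ≤ E := Nat.le_ceil _
  have hE2 : (E : ℝ) ≤ 4 * c ^ 2 * T := by
    have h := Nat.ceil_lt_add_one (show 0 ≤ 3 * c ^ 2 * T by positivity)
    have : 1 ≤ c ^ 2 * T := one_le_mul_of_one_le_of_one_le hc2 hT1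
    linarith
  have hE0 : 0 < E := Nat.ceil_pos.2 (by positivity)
  have hent' : ∀ i j, ‖(Aᴴ * F + Fᴴ * A - Fᴴ * F) i j‖ ≤ E * (w i * w j) := fun i j =>
    (hent i j).trans (mul_le_mul_of_nonneg_right hE1
      (mul_nonneg (Real.sqrt_nonneg _) (Real.sqrt_nonneg _)))
  have hRint : ∀ i j, R i j ∈ intO ℓ := fun i j => by
    simp only [R, Matrix.sub_apply, Matrix.smul_apply, smul_eq_mul]
    exact sub_mem (mul_mem (natCast_mem _ _) (hM i j)) (apply_mem_intO_of_mem_sumsOfNorms hBB i j)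
  have hRh : R.IsHermitian := by
    refine Matrix.IsHermitian.sub ?_ (isHermitian_of_mem_sumsOfNorms hBB)
    ext i j
    simp [hMh.apply]
  have hRmem : R ∈ sumsOfNorms ℓ n := by
    refine mem_sumsOfNorms_of_dominant hℓ hRint hRh hμ hE0 (fun i j hij => ?_) fun i => ?_
    · have e : R i j = (Aᴴ * F + Fᴴ * A - Fᴴ * F) i j := by
        rw [hRe, Matrix.add_apply, hDoff i j hij, zero_add]
      rw [e, ← hw2 i, ← hw2 j]
      calc _ ≤ (E * (w i * w j)) ^ 2 := by gcongr; exact hent' i j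
        _ = _ := by ring
    · have e : (R i i).re = s * μ i / X + ((Aᴴ * F + Fᴴ * A - Fᴴ * F) i i).re := by
        rw [hRe, Matrix.add_apply, hDdiag, Complex.add_re, Complex.ofReal_re]
      have h1 : -(E * μ i) ≤ ((Aᴴ * F + Fᴴ * A - Fᴴ * F) i i).re := by
        have := (Complex.abs_re_le_norm _).trans (hent' i i)
        rw [← sq, hw2] at this
        exact (abs_le.1 this).1
      have h2 : (8 * n * c ^ 2 + 1) * E ≤ s / X := by
        have h3 : 36 * c ^ 4 * X * n * T ≤ s := by
          have h4 : (36 * c ^ 4 * X * n * T) ^ 2 ≤ (s : ℝ) ^ 2 := by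
            calc (36 * c ^ 4 * X * n * T) ^ 2 = (36 * c ^ 4 * X) ^ 2 * n ^ 2 * T ^ 2 := by ring
              _ = ((36 * c ^ 4 * X) ^ 2 * n ^ 3) * s := by rw [hT2]; ring
              _ ≤ s * s := by gcongr
              _ = _ := by ring
          exact le_of_sq_le_sq h4 (by positivity)
        have h5 : (1 : ℝ) ≤ n * c ^ 2 := one_le_mul_of_one_le_of_one_le hnR hc2
        rw [le_div_iff₀ hX0]
        calc (8 * n * c ^ 2 + 1) * E * X ≤ (9 * (n * c ^ 2)) * (4 * c ^ 2 * T) * X := by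
              gcongr
              linarith
          _ = 36 * c ^ 4 * X * n * T := by ring
          _ ≤ s := h3
      have h6 := mul_le_mul_of_nonneg_right h2 (show (0 : ℝ) ≤ μ i by positivity)
      have h7 : (s : ℝ) / X * μ i = s * μ i / X := by ring
      rw [e]
      linarith
  have : (s : ℂ) • M = R + B'ᴴ * B' := by simp [R]
  rw [this]
  exact add_mem hRmem hBB

end Rounding

section Unimodular

/-- Over a principal ideal domain, a nonzero vector is a multiple of a column of an invertible
matrix. -/
lemma exists_unimodular_smul_col {R : Type*} [CommRing R] [IsDomain R] [IsPrincipalIdealRing R]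
    {n : ℕ} {v : Fin (n + 1) → R} (hv : v ≠ 0) :
    ∃ (G G' : Matrix (Fin (n + 1)) (Fin (n + 1)) R) (a : R), G * G' = 1 ∧ v = a • G.col 0 := by
  obtain ⟨m, S⟩ := Submodule.smithNormalForm (Pi.basisFun R (Fin (n + 1))) (R ∙ v)
  have hm : m = 1 := by
    have h1 := Module.finrank_eq_card_basis S.bN
    rw [← (LinearEquiv.toSpanNonzeroSingleton R _ v hv).finrank_eq] at h1
    simpa using h1.symm
  subst hm
  set b := S.bM.reindex (Equiv.swap 0 (S.f 0))
  refine ⟨(Pi.basisFun R _).toMatrix b, b.toMatrix (Pi.basisFun R _),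
    S.bN.repr ⟨v, Submodule.mem_span_singleton_self v⟩ 0 * S.a 0,
    Module.Basis.toMatrix_mul_toMatrix_flip _ _, ?_⟩
  have h := congrArg Subtype.val (S.bN.sum_repr ⟨v, Submodule.mem_span_singleton_self v⟩)
  simp only [Fin.sum_univ_one, Submodule.coe_smul, S.snf] at h
  refine h.symm.trans ?_
  rw [smul_smul]
  congr 1
  ext i
  simp [b, Matrix.col_apply, Module.Basis.toMatrix_apply]

lemma exists_intO_unimodular_smul_col {ℓ n : ℕ} [IsPrincipalIdealRing (intO ℓ)]
    {v : Fin (n + 1) → ℂ} (hv : ∀ i, v i ∈ intO ℓ) (hv0 : v ≠ 0) :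
    ∃ G G' : Matrix (Fin (n + 1)) (Fin (n + 1)) ℂ, (∀ i j, G i j ∈ intO ℓ) ∧
      (∀ i j, G' i j ∈ intO ℓ) ∧ G * G' = 1 ∧ ∃ a ∈ intO ℓ, v = a • G.col 0 := by
  have hw0 : (fun i => ⟨v i, hv i⟩ : Fin (n + 1) → intO ℓ) ≠ 0 := fun h =>
    hv0 (funext fun i => congrArg Subtype.val (congrFun h i))
  obtain ⟨G, G', a, hG, ha⟩ := exists_unimodular_smul_col hw0
  refine ⟨(intO ℓ).subtype.mapMatrix G, (intO ℓ).subtype.mapMatrix G', fun i j => (G i j).2,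
    fun i j => (G' i j).2, ?_, a, a.2, ?_⟩
  · rw [← map_mul, hG, map_one]
  · ext i
    exact congrArg Subtype.val (congrFun ha i)

end Unimodular

section HermitianForm

variable {n : ℕ}

/-- The value `x* M x` of a hermitian form, as a real number. -/
noncomputable def hermVal (M : Matrix (Fin n) (Fin n) ℂ) (x : Fin n → ℂ) : ℝ :=
  (star x ⬝ᵥ M *ᵥ x).re

lemma hermVal_conj (M G : Matrix (Fin n) (Fin n) ℂ) (x : Fin n → ℂ) :
    hermVal (Gᴴ * M * G) x = hermVal M (G *ᵥ x) := by
  unfold hermVal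
  rw [Matrix.star_mulVec, ← Matrix.dotProduct_mulVec, Matrix.mulVec_mulVec, Matrix.mulVec_mulVec,
    Matrix.mul_assoc]

lemma hermVal_smul (M : Matrix (Fin n) (Fin n) ℂ) (a : ℂ) (x : Fin n → ℂ) :
    hermVal M (a • x) = Complex.normSq a * hermVal M x := by
  unfold hermVal
  rw [Matrix.mulVec_smul, star_smul, smul_dotProduct, dotProduct_smul, smul_smul, smul_eq_mul,
    show star a * a = (Complex.normSq a : ℂ) from (Complex.normSq_eq_conj_mul_self).symm,
    Complex.re_ofReal_mul]

lemma hermVal_pos {M : Matrix (Fin n) (Fin n) ℂ} (hM : M.PosDef) {x : Fin n → ℂ} (hx : x ≠ 0) :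
    0 < hermVal M x := (Complex.pos_iff.1 (hM.dotProduct_mulVec_pos hx)).1

lemma hermVal_single (M : Matrix (Fin n) (Fin n) ℂ) (i : Fin n) :
    hermVal M (Pi.single i 1) = (M i i).re := by
  simp [hermVal]

lemma Matrix.PosDef.conj {M G G' : Matrix (Fin n) (Fin n) ℂ} (hM : M.PosDef) (hG : G * G' = 1) :
    (Gᴴ * M * G).PosDef := by
  refine hM.conjTranspose_mul_mul_same ?_
  have hG' : G' * G = 1 := mul_eq_one_comm.1 hG
  refine Function.LeftInverse.injective (g := fun x => G' *ᵥ x) fun x => ?_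
  simp [hG']

variable {ℓ : ℕ}

lemma exists_pos_le_hermVal (hℓ : 0 < ℓ) {M : Matrix (Fin n) (Fin n) ℂ} (hM : M.PosDef) :
    ∃ δ > 0, ∀ x : Fin n → ℂ, (∀ i, x i ∈ intO ℓ) → x ≠ 0 → δ ≤ hermVal M x := by
  obtain ⟨A, hA⟩ : ∃ A : Matrix (Fin n) (Fin n) ℂ, M = Aᴴ * A := by
    open scoped MatrixOrder in
    exact CStarAlgebra.nonneg_iff_eq_star_mul_self.1 hM.posSemidef.nonneg
  have hinv : M⁻¹ * (Aᴴ * A) = 1 := by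
    rw [← hA]
    exact Matrix.nonsing_inv_mul _ ((Matrix.isUnit_iff_isUnit_det _).1 hM.isUnit)
  set L := (Matrix.toLin' (M⁻¹ * Aᴴ)).toContinuousLinearMap
  refine ⟨1 / (‖L‖ ^ 2 + 1), by positivity, fun x hx hx0 => ?_⟩
  obtain ⟨i, hi⟩ := Function.ne_iff.1 hx0
  have h1 : 1 ≤ ‖x‖ := by
    refine le_trans ?_ (norm_le_pi_norm x i)
    have := one_le_normSq_of_mem_intO hℓ (hx i) hi
    rwa [Complex.normSq_eq_norm_sq, one_le_sq_iff₀ (norm_nonneg _)] at this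
  have h2 : ‖x‖ ≤ ‖L‖ * ‖A *ᵥ x‖ := by
    have e : x = L (A *ᵥ x) := by simp [L, hinv]
    conv_lhs => rw [e]
    exact L.le_opNorm _
  have h3 : ‖A *ᵥ x‖ ^ 2 ≤ hermVal M x := by
    have e : hermVal M x = ∑ k, ‖(A *ᵥ x) k‖ ^ 2 := by
      have h := hermVal_conj 1 A x
      rw [Matrix.mul_one, ← hA] at h
      rw [h, hermVal, Matrix.one_mulVec, dotProduct, Complex.re_sum]
      refine Finset.sum_congr rfl fun k _ => ?_
      rw [← Complex.normSq_eq_norm_sq, Complex.normSq_apply]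
      simp
    rw [e]
    have hs : 0 ≤ ∑ k, ‖(A *ᵥ x) k‖ ^ 2 := by positivity
    rw [← Real.sq_sqrt hs]
    refine pow_le_pow_left₀ (norm_nonneg _) ((pi_norm_le_iff_of_nonneg (Real.sqrt_nonneg _)).2
      fun k => Real.le_sqrt_of_sq_le ?_) 2
    exact Finset.single_le_sum (f := fun k => ‖(A *ᵥ x) k‖ ^ 2) (fun _ _ => by positivity)
      (Finset.mem_univ k)
  rw [div_le_iff₀ (by positivity)]
  have h4 : 1 ≤ ‖L‖ ^ 2 * ‖A *ᵥ x‖ ^ 2 := by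
    rw [← mul_pow]
    exact one_le_pow₀ (h1.trans h2)
  nlinarith [sq_nonneg ‖L‖, sq_nonneg ‖A *ᵥ x‖]

/-- A vector that is minimal up to a factor of two. -/
lemma exists_almost_minimal (hℓ : 0 < ℓ) {M : Matrix (Fin (n + 1)) (Fin (n + 1)) ℂ}
    (hM : M.PosDef) : ∃ v : Fin (n + 1) → ℂ, (∀ i, v i ∈ intO ℓ) ∧ v ≠ 0 ∧
      ∀ x : Fin (n + 1) → ℂ, (∀ i, x i ∈ intO ℓ) → x ≠ 0 → hermVal M v ≤ 2 * hermVal M x := by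
  obtain ⟨δ, hδ, hle⟩ := exists_pos_le_hermVal hℓ hM
  set S : Set ℝ := hermVal M '' {x | (∀ i, x i ∈ intO ℓ) ∧ x ≠ 0}
  have hne : S.Nonempty := ⟨_, 1, ⟨fun _ => one_mem _, one_ne_zero⟩, rfl⟩
  have hbdd : ∀ y ∈ S, δ ≤ y := by
    rintro _ ⟨x, hx, rfl⟩
    exact hle x hx.1 hx.2
  have hpos : 0 < sInf S := hδ.trans_le (le_csInf hne hbdd)
  obtain ⟨_, ⟨v, hv, rfl⟩, hlt⟩ := exists_lt_of_csInf_lt hne (show sInf S < 2 * sInf S by linarith)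
  refine ⟨v, hv.1, hv.2, fun x hx hx0 => ?_⟩
  have := csInf_le ⟨δ, hbdd⟩ (show hermVal M x ∈ S from ⟨x, ⟨hx, hx0⟩, rfl⟩)
  linarith

lemma mulVec_mem_intO {m : ℕ} {G : Matrix (Fin m) (Fin n) ℂ} (hG : ∀ i j, G i j ∈ intO ℓ)
    {x : Fin n → ℂ} (hx : ∀ i, x i ∈ intO ℓ) (i) : (G *ᵥ x) i ∈ intO ℓ := by
  rw [Matrix.mulVec, dotProduct]
  exact sum_mem fun j _ => mul_mem (hG i j) (hx j)

lemma mulVec_ne_zero_of_mul_eq_one {G G' : Matrix (Fin n) (Fin n) ℂ} (hG : G * G' = 1)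
    {x : Fin n → ℂ} (hx : x ≠ 0) : G *ᵥ x ≠ 0 := by
  intro h
  have : G' *ᵥ (G *ᵥ x) = x := by simp [mul_eq_one_comm.1 hG]
  rw [h, Matrix.mulVec_zero] at this
  exact hx this.symm

/-- A basis of `𝓞ⁿ⁺¹` whose first vector is minimal up to a factor of two. -/
lemma exists_unimodular_almost_minimal (hℓ : 0 < ℓ) [IsPrincipalIdealRing (intO ℓ)]
    {M : Matrix (Fin (n + 1)) (Fin (n + 1)) ℂ} (hM : M.PosDef) :
    ∃ G G' : Matrix (Fin (n + 1)) (Fin (n + 1)) ℂ, (∀ i j, G i j ∈ intO ℓ) ∧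
      (∀ i j, G' i j ∈ intO ℓ) ∧ G * G' = 1 ∧ ∀ x : Fin (n + 1) → ℂ, (∀ i, x i ∈ intO ℓ) →
        x ≠ 0 → ((Gᴴ * M * G) 0 0).re ≤ 2 * hermVal (Gᴴ * M * G) x := by
  obtain ⟨v, hv, hv0, hmin⟩ := exists_almost_minimal hℓ hM
  obtain ⟨G, G', hG, hG', hGG', a, ha, rfl⟩ := exists_intO_unimodular_smul_col hv hv0
  refine ⟨G, G', hG, hG', hGG', fun x hx hx0 => ?_⟩
  rw [← hermVal_single, hermVal_conj, hermVal_conj, Matrix.mulVec_single_one]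
  refine le_trans ?_ (hmin _ (mulVec_mem_intO hG hx) (mulVec_ne_zero_of_mul_eq_one hGG' hx0))
  rw [hermVal_smul]
  have ha0 : a ≠ 0 := by
    rintro rfl
    simp at hv0
  have hG0 : G.col 0 ≠ 0 := by
    intro h
    simp [h] at hv0
  exact le_mul_of_one_le_left (hermVal_pos hM hG0).le (one_le_normSq_of_mem_intO hℓ ha ha0)

/-- The block matrix with first row `(1, r)` and remaining rows `(0, A)`. -/
def bordered (r : Fin n → ℂ) (A : Matrix (Fin n) (Fin n) ℂ) :
    Matrix (Fin (n + 1)) (Fin (n + 1)) ℂ :=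
  Matrix.of fun i => Fin.cases (Fin.cons 1 r : Fin (n + 1) → ℂ)
    (fun i => (Fin.cons 0 (A i) : Fin (n + 1) → ℂ)) i

lemma bordered_mulVec (r : Fin n → ℂ) (A : Matrix (Fin n) (Fin n) ℂ) (t : ℂ) (y : Fin n → ℂ) :
    bordered r A *ᵥ (Fin.cons t y : Fin (n + 1) → ℂ) =
      (Fin.cons (t + r ⬝ᵥ y) (A *ᵥ y) : Fin (n + 1) → ℂ) := by
  ext i
  refine Fin.cases ?_ (fun i => ?_) i <;>
    simp [bordered, Matrix.mulVec, dotProduct, Fin.sum_univ_succ]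

lemma bordered_zero_mul_bordered_zero (A B : Matrix (Fin n) (Fin n) ℂ) (h : A * B = 1) :
    bordered 0 A * bordered 0 B = 1 := by
  ext i j
  have h' := fun i j => congrFun (congrFun h i) j
  simp only [Matrix.mul_apply] at h'
  refine Fin.cases ?_ (fun i => ?_) i <;> refine Fin.cases ?_ (fun j => ?_) j <;>
    simp [bordered, Matrix.mul_apply, Fin.sum_univ_succ, h', Matrix.one_apply, Fin.succ_ne_zero,
      (Fin.succ_ne_zero _).symm]

lemma bordered_zero_mem_intO {A : Matrix (Fin n) (Fin n) ℂ} (hA : ∀ i j, A i j ∈ intO ℓ) (i j) :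
    bordered 0 A i j ∈ intO ℓ := by
  refine Fin.cases ?_ (fun i => ?_) i <;> refine Fin.cases ?_ (fun j => ?_) j <;>
    simp [bordered, hA, zero_mem, one_mem]

lemma UpperUnitri.bordered (r : Fin n → ℂ) {A : Matrix (Fin n) (Fin n) ℂ} (hA : UpperUnitri A) :
    UpperUnitri (bordered r A) := by
  constructor
  · intro i
    refine Fin.cases ?_ (fun i => ?_) i <;> simp [_root_.bordered, hA.diag]
  · intro i j
    refine Fin.cases ?_ (fun i => ?_) i <;> refine Fin.cases ?_ (fun j => ?_) j <;>
      simp +contextual [_root_.bordered, hA.lower]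

/-- The Schur complement of the first diagonal entry. -/
noncomputable def schurCompl (M : Matrix (Fin (n + 1)) (Fin (n + 1)) ℂ) :
    Matrix (Fin n) (Fin n) ℂ :=
  Matrix.of fun i j => M i.succ j.succ - M i.succ 0 * M 0 j.succ / M 0 0

lemma hermVal_cons {M : Matrix (Fin (n + 1)) (Fin (n + 1)) ℂ} (hM : M.IsHermitian)
    (h0 : (M 0 0).re ≠ 0) (t : ℂ) (y : Fin n → ℂ) :
    hermVal M (Fin.cons t y : Fin (n + 1) → ℂ) =
      (M 0 0).re * Complex.normSq (t + (fun j => M 0 (Fin.succ j) / M 0 0) ⬝ᵥ y) +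
        hermVal (schurCompl M) y := by
  have hreal : ((M 0 0).re : ℂ) = M 0 0 :=
    Complex.ext rfl (by simpa using (hM.im_apply_self_eq_zero 0).symm)
  have h00 : M 0 0 ≠ 0 := fun h => h0 (by simp [h])
  set T := ∑ j, M 0 (Fin.succ j) * y j
  have hT : (fun j => M 0 (Fin.succ j) / M 0 0) ⬝ᵥ y = T / M 0 0 := by
    simp only [dotProduct, T, Finset.sum_div]
    exact Finset.sum_congr rfl fun j _ => by ring
  have hT' : ∑ i, star (y i) * M (Fin.succ i) 0 = star T := by
    simp only [T, star_sum, star_mul', hM.apply]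
    exact Finset.sum_congr rfl fun j _ => by ring
  have e : (star (Fin.cons t y : Fin (n + 1) → ℂ) ⬝ᵥ M *ᵥ (Fin.cons t y : Fin (n + 1) → ℂ)) =
      M 0 0 * (star (t + T / M 0 0) * (t + T / M 0 0)) + star y ⬝ᵥ schurCompl M *ᵥ y := by
    have h1 : star y ⬝ᵥ schurCompl M *ᵥ y =
        ∑ i, star (y i) * ∑ j, M (Fin.succ i) (Fin.succ j) * y j - star T * T / M 0 0 := by
      rw [← hT', Finset.sum_mul, Finset.sum_div, ← Finset.sum_sub_distrib]
      refine Finset.sum_congr rfl fun i _ => ?_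
      simp only [Matrix.mulVec, dotProduct, schurCompl, Matrix.of_apply, sub_mul,
        Finset.sum_sub_distrib, Pi.star_apply, mul_sub, T, Finset.mul_sum, Finset.sum_div]
      congr 1
      exact Finset.sum_congr rfl fun j _ => by ring
    have h2 : ∑ i, star (y i) * (M (Fin.succ i) 0 * t +
        ∑ j, M (Fin.succ i) (Fin.succ j) * y j) =
        star T * t + ∑ i, star (y i) * ∑ j, M (Fin.succ i) (Fin.succ j) * y j := by
      rw [← hT', Finset.sum_mul, ← Finset.sum_add_distrib]
      exact Finset.sum_congr rfl fun i _ => by ring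
    have hs : star (M 0 0) = M 0 0 := hM.apply 0 0
    rw [h1]
    simp only [Matrix.mulVec, dotProduct, Fin.sum_univ_succ, Fin.cons_zero, Fin.cons_succ,
      Pi.star_apply]
    rw [h2, star_add, star_div₀, hs]
    change star t * (M 0 0 * t + T) + _ = _
    field_simp
    ring
  have e2 : M 0 0 * (star (t + T / M 0 0) * (t + T / M 0 0)) =
      (((M 0 0).re * Complex.normSq (t + T / M 0 0) : ℝ) : ℂ) := by
    rw [Complex.ofReal_mul, hreal, Complex.normSq_eq_conj_mul_self]
    rfl
  rw [hT, hermVal, hermVal, e, e2, Complex.add_re, Complex.ofReal_re]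

lemma Matrix.PosDef.schurCompl {M : Matrix (Fin (n + 1)) (Fin (n + 1)) ℂ} (hM : M.PosDef) :
    (schurCompl M).PosDef := by
  have hh : (_root_.schurCompl M).IsHermitian := by
    ext i j
    simp [_root_.schurCompl, hM.1.apply, mul_comm]
  refine Matrix.PosDef.of_dotProduct_mulVec_pos hh fun y hy => ?_
  rw [Complex.pos_iff]
  refine ⟨?_, (hh.im_star_dotProduct_mulVec_self y).symm⟩
  have h0 : 0 < (M 0 0).re := by
    rw [← hermVal_single]
    exact hermVal_pos hM (by simp)
  have h := hermVal_cons hM.1 h0.ne' (-((fun j => M 0 (Fin.succ j) / M 0 0) ⬝ᵥ y)) y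
  rw [neg_add_cancel, map_zero, mul_zero, zero_add] at h
  change 0 < hermVal _ y
  rw [← h]
  refine hermVal_pos hM fun h => hy (funext fun i => ?_)
  simpa using congrFun h i.succ

/-- Hermite–Korkine–Zolotarev reduction, with minimality up to a factor of two. -/
lemma exists_korkineZolotarev_reduction (hℓ : 0 < ℓ) [IsPrincipalIdealRing (intO ℓ)]
    (M : Matrix (Fin n) (Fin n) ℂ) (hM : M.PosDef) :
    ∃ (G G' U : Matrix (Fin n) (Fin n) ℂ) (h : Fin n → ℝ), (∀ i j, G i j ∈ intO ℓ) ∧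
      (∀ i j, G' i j ∈ intO ℓ) ∧ G * G' = 1 ∧ UpperUnitri U ∧ (∀ k, 0 < h k) ∧
      (∀ x, hermVal M (G *ᵥ x) = ∑ k, h k * Complex.normSq ((U *ᵥ x) k)) ∧
      ∀ i, ∀ z : Fin n → ℂ, (∀ k, z k ∈ intO ℓ) → (∃ k, i ≤ k ∧ z k ≠ 0) →
        h i ≤ 2 * ∑ k, if i ≤ k then h k * Complex.normSq ((U *ᵥ z) k) else 0 := by
  induction n with
  | zero =>
    exact ⟨1, 1, 1, 0, fun i => i.elim0, fun i => i.elim0, by simp,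
      ⟨fun i => i.elim0, fun i => i.elim0⟩, fun i => i.elim0, fun x => by simp [hermVal],
      fun i => i.elim0⟩
  | succ n ih =>
    obtain ⟨G₁, G₁', hG₁, hG₁', h₁, hmin⟩ := exists_unimodular_almost_minimal hℓ hM
    have hM₁ := hM.conj h₁
    set M₁ := G₁ᴴ * M * G₁
    obtain ⟨G₂, G₂', U, h, hG₂, hG₂', h₂, hU, hpos, hval, hred⟩ :=
      ih (schurCompl M₁) hM₁.schurCompl
    have h0 : 0 < (M₁ 0 0).re := by
      rw [← hermVal_single]
      exact hermVal_pos hM₁ (by simp)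
    set r : Fin n → ℂ := fun j => M₁ 0 (Fin.succ j) / M₁ 0 0
    have hval' : ∀ x, hermVal M₁ (bordered 0 G₂ *ᵥ x) = ∑ k, (Fin.cons (M₁ 0 0).re h :
        Fin (n + 1) → ℝ) k * Complex.normSq ((bordered (r ᵥ* G₂) U *ᵥ x) k) := by
      intro x
      rw [← Fin.cons_self_tail x, bordered_mulVec, bordered_mulVec, hermVal_cons hM₁.1 h0.ne', hval,
        Fin.sum_univ_succ]
      simp [r, Matrix.dotProduct_mulVec]
    refine ⟨G₁ * bordered 0 G₂, bordered 0 G₂' * G₁', bordered (r ᵥ* G₂) U,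
      Fin.cons (M₁ 0 0).re h, mul_apply_mem_intO hG₁ (bordered_zero_mem_intO hG₂),
      mul_apply_mem_intO (bordered_zero_mem_intO hG₂') hG₁', ?_, hU.bordered _,
      Fin.cases h0 hpos, fun x => ?_, Fin.cases (fun z hz hz0 => ?_) fun i z hz hz0 => ?_⟩
    · rw [Matrix.mul_assoc, ← Matrix.mul_assoc (bordered 0 G₂),
        bordered_zero_mul_bordered_zero _ _ h₂, Matrix.one_mul, h₁]
    · rw [← hval', hermVal_conj, Matrix.mulVec_mulVec]
    · obtain ⟨k, -, hk⟩ := hz0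
      have hz' : z ≠ 0 := fun h => hk (congrFun h k)
      have := hmin _ (mulVec_mem_intO (bordered_zero_mem_intO hG₂) hz)
        (mulVec_ne_zero_of_mul_eq_one (bordered_zero_mul_bordered_zero _ _ h₂) hz')
      rw [hval'] at this
      simpa using this
    · obtain ⟨k, hik, hk⟩ := hz0
      obtain ⟨k, rfl⟩ := Fin.exists_succ_eq.2 ((Fin.succ_pos i).trans_le hik).ne'
      have := hred i (Fin.tail z) (fun k => hz k.succ) ⟨k, Fin.succ_le_succ_iff.1 hik, hk⟩
      rw [← Fin.cons_self_tail z, bordered_mulVec, Fin.sum_univ_succ]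
      simpa [Fin.succ_le_succ_iff] using this

end HermitianForm

section RatioBound

variable {ℓ n : ℕ}

/-- The lattice spanned by a block of a reduced basis satisfies a Minkowski type inequality. -/
lemma UpperUnitri.pow_le_prod_block (hℓ : 0 < ℓ) {U : Matrix (Fin n) (Fin n) ℂ}
    (hU : UpperUnitri U) {h : Fin n → ℝ} (hpos : ∀ k, 0 < h k)
    (hred : ∀ i, ∀ z : Fin n → ℂ, (∀ k, z k ∈ intO ℓ) → (∃ k, i ≤ k ∧ z k ≠ 0) →
      h i ≤ 2 * ∑ k, if i ≤ k then h k * Complex.normSq ((U *ᵥ z) k) else 0)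
    {i m : ℕ} (him : i + m ≤ n) (hm : 0 < m) :
    h ⟨i, by omega⟩ ^ m ≤
      (16 * n * parDiam ℓ ^ 2) ^ m * ∏ k : Fin m, h ⟨i + k, by omega⟩ := by
  by_contra! hlt
  set e : Fin m → Fin n := fun k => ⟨i + k, by omega⟩
  set i' : Fin n := ⟨i, by omega⟩
  have he : StrictMono e := fun a b hab => by simpa [e] using hab
  have hc := one_le_parDiam ℓ
  have hn : 0 < n := by omega
  have hnR : (0 : ℝ) < n := by exact_mod_cast hn
  set C := 4 * n * parDiam ℓ ^ 2
  have hC : 0 < C := by positivity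
  have hi := hpos i'
  have hq : ∀ k, 0 < h i' / (C * h (e k)) := fun k => div_pos hi (mul_pos hC (hpos _))
  have hprod : (2 : ℝ) ^ m < ∏ k : Fin m, Real.sqrt (h i' / (C * h (e k))) := by
    refine lt_of_pow_lt_pow_left₀ 2 (Finset.prod_nonneg fun _ _ => Real.sqrt_nonneg _) ?_
    rw [← Finset.prod_pow]
    simp only [Real.sq_sqrt (hq _).le]
    rw [Finset.prod_div_distrib, Finset.prod_mul_distrib]
    simp only [Finset.prod_const, Finset.card_univ, Fintype.card_fin]
    rw [lt_div_iff₀ (mul_pos (pow_pos hC m) (Finset.prod_pos fun k _ => hpos _))]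
    refine lt_of_eq_of_lt ?_ hlt
    rw [show 16 * (n : ℝ) * parDiam ℓ ^ 2 = 2 ^ 2 * C by simp only [C]; ring, mul_pow _ C,
      ← pow_mul, ← pow_mul, mul_comm m 2, mul_assoc]
  obtain ⟨z, hz, hz0, hzle⟩ := (hU.submatrix he).exists_norm_mulVec_le hℓ
    (fun k => Real.sqrt_pos.2 (hq k)) hprod
  set w : Fin n → ℂ := Function.extend e z 0
  have hw : ∀ k, w (e k) = z k := he.injective.extend_apply z 0
  have hw' : ∀ a, a ∉ Set.range e → w a = 0 := fun a ha =>
    Function.extend_apply' z (0 : Fin n → ℂ) a ha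
  have hUw : ∀ a, (U *ᵥ w) a = ∑ k, U a (e k) * z k := by
    intro a
    refine (Fintype.sum_of_injective e he.injective _ _ (fun b hb => ?_) fun k => ?_).symm
    · rw [hw' b hb, mul_zero]
    · rw [hw]
  obtain ⟨k₀, hk₀⟩ := Function.ne_iff.1 hz0
  have hkey := hred i' w (fun a => by
    by_cases ha : a ∈ Set.range e
    · obtain ⟨k, rfl⟩ := ha
      rw [hw]
      exact hz k
    · rw [hw' a ha]
      exact zero_mem _) ⟨e k₀, Fin.mk_le_mk.2 (Nat.le_add_right _ _), by rw [hw]; exact hk₀⟩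
  have hsum : (∑ k, if i' ≤ k then h k * Complex.normSq ((U *ᵥ w) k) else 0) =
      ∑ k, h (e k) * Complex.normSq ((U.submatrix e e *ᵥ z) k) := by
    refine (Fintype.sum_of_injective e he.injective _ _ (fun a ha => ?_) fun k => ?_).symm
    · split_ifs with hia
      · have : (U *ᵥ w) a = 0 := by
          rw [hUw]
          refine Finset.sum_eq_zero fun k _ => ?_
          rw [hU.lower, zero_mul]
          rw [Fin.lt_def]
          have h1 : i ≤ (a : ℕ) := hia
          by_contra! h2
          have h3 : (a : ℕ) ≤ i + k := h2
          exact ha ⟨⟨a - i, by omega⟩, Fin.ext (by simp only [e]; omega)⟩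
        rw [this, map_zero, mul_zero]
      · rfl
    · rw [if_pos (Fin.mk_le_mk.2 (Nat.le_add_right _ _)), hUw]
      rfl
  rw [hsum] at hkey
  have hle : ∑ k, h (e k) * Complex.normSq ((U.submatrix e e *ᵥ z) k) ≤ h i' / 4 := by
    calc _ ≤ ∑ _k : Fin m, parDiam ℓ ^ 2 * h i' / C := by
          refine Finset.sum_le_sum fun k _ => ?_
          have h1 := pow_le_pow_left₀ (norm_nonneg _) (hzle k) 2
          rw [mul_pow, Real.sq_sqrt (hq k).le, ← Complex.normSq_eq_norm_sq] at h1
          have hk := hpos (e k)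
          calc _ ≤ h (e k) * (parDiam ℓ ^ 2 * (h i' / (C * h (e k)))) := by gcongr
            _ = _ := by field_simp
      _ = m * (h i' / (4 * n)) := by
          simp only [Finset.sum_const, Finset.card_univ, Fintype.card_fin, nsmul_eq_mul, C]
          field_simp
      _ ≤ n * (h i' / (4 * n)) := by
          have : (m : ℝ) ≤ n := by exact_mod_cast (by omega : m ≤ n)
          gcongr
      _ = _ := by field_simp
  linarith

lemma le_two_mul_one_add_harmonic {b : ℕ → ℝ} {g : ℝ} (hg : 0 ≤ g) {N : ℕ}
    (hb : ∀ k ≤ N, (k + 1) * b k ≤ (k + 1) * g + ∑ l ∈ Finset.range (k + 1), b l) (h0 : b 0 ≤ 0)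
    {k : ℕ} (hk : k ≤ N) : b k ≤ 2 * g * (1 + harmonic k) := by
  have hsum : ∀ k : ℕ, ∑ l ∈ Finset.range k, (1 + (harmonic l : ℝ)) = k * harmonic k := by
    intro k
    induction k with
    | zero => simp
    | succ k ih =>
      rw [Finset.sum_range_succ, ih, harmonic_succ]
      push_cast
      field_simp
      ring
  induction k using Nat.strong_induction_on with
  | _ k ih =>
    rcases Nat.eq_zero_or_pos k with rfl | hk0
    · simpa using h0.trans (by positivity)
    · have hkR : (1 : ℝ) ≤ k := by exact_mod_cast hk0
      have h1 := hb k hk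
      rw [Finset.sum_range_succ] at h1
      have h2 : ∑ l ∈ Finset.range k, b l ≤ ∑ l ∈ Finset.range k, 2 * g * (1 + harmonic l) :=
        Finset.sum_le_sum fun l hl => ih l (Finset.mem_range.1 hl)
          ((Finset.mem_range.1 hl).le.trans hk)
      rw [← Finset.mul_sum, hsum] at h2
      have h3 : k * b k ≤ k * (2 * g * (1 + harmonic k)) := by nlinarith
      exact le_of_mul_le_mul_left h3 (by linarith)

/-- The diagonal entries of a reduced basis do not decrease fast. -/
lemma UpperUnitri.le_exp_mul_of_reduced (hℓ : 0 < ℓ) {U : Matrix (Fin n) (Fin n) ℂ}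
    (hU : UpperUnitri U) {h : Fin n → ℝ} (hpos : ∀ k, 0 < h k)
    (hred : ∀ i, ∀ z : Fin n → ℂ, (∀ k, z k ∈ intO ℓ) → (∃ k, i ≤ k ∧ z k ≠ 0) →
      h i ≤ 2 * ∑ k, if i ≤ k then h k * Complex.normSq ((U *ᵥ z) k) else 0)
    {i j : Fin n} (hij : i ≤ j) :
    h i ≤ Real.exp (2 * Real.log (16 * n * parDiam ℓ ^ 2) * (2 + Real.log n)) * h j := by
  have hc := one_le_parDiam ℓ
  have hn : (1 : ℝ) ≤ n := by exact_mod_cast i.pos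
  set g := Real.log (16 * n * parDiam ℓ ^ 2)
  have hC : 1 ≤ 16 * n * parDiam ℓ ^ 2 :=
    one_le_mul_of_one_le_of_one_le (by linarith) (one_le_pow₀ hc)
  have hg : 0 ≤ g := Real.log_nonneg hC
  set H : ℕ → ℝ := fun k => if hk : k < n then Real.log (h ⟨k, hk⟩) else 0
  have hH : ∀ k (hk : k < n), H k = Real.log (h ⟨k, hk⟩) := fun k hk => dif_pos hk
  have hb : ∀ k ≤ (j : ℕ), ((k : ℝ) + 1) * (H (j - k) - H j) ≤ (k + 1) * g +
      ∑ l ∈ Finset.range (k + 1), (H (j - l) - H j) := by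
    intro k hk
    have hjn := j.2
    have h1 := Real.log_le_log (pow_pos (hpos _) _)
      (hU.pow_le_prod_block hℓ hpos hred (i := j - k) (m := k + 1) (by omega) k.succ_pos)
    rw [Real.log_mul (by positivity) (Finset.prod_ne_zero_iff.2 fun _ _ => (hpos _).ne'),
      Real.log_pow, Real.log_pow, Real.log_prod fun _ _ => (hpos _).ne', ← hH] at h1
    have h2 : ∑ t : Fin (k + 1), Real.log (h ⟨j - k + t, by omega⟩) =
        ∑ l ∈ Finset.range (k + 1), H (j - l) := by
      rw [← Finset.sum_range_reflect, Finset.sum_range]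
      refine Finset.sum_congr rfl fun t _ => ?_
      rw [← hH]
      congr 1
      omega
    rw [h2] at h1
    push_cast at h1
    rw [Finset.sum_sub_distrib]
    simp only [Finset.sum_const, Finset.card_range, nsmul_eq_mul]
    push_cast
    linarith
  have h3 := le_two_mul_one_add_harmonic hg hb (by simp) (show (j : ℕ) - i ≤ j by omega)
  have hij' : (i : ℕ) ≤ j := hij
  rw [Nat.sub_sub_self hij', hH _ i.2, hH _ j.2] at h3
  have h4 : (harmonic (j - i) : ℝ) ≤ 1 + Real.log n := by
    refine le_trans ?_ (harmonic_le_one_add_log n)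
    have : harmonic (j - i) ≤ harmonic n := by
      refine Finset.sum_le_sum_of_subset_of_nonneg (Finset.range_mono (by omega)) fun _ _ _ => ?_
      positivity
    exact_mod_cast this
  have h5 : Real.log (h i) ≤ 2 * g * (2 + Real.log n) + Real.log (h j) := by
    have : 2 * g * (1 + harmonic (j - i)) ≤ 2 * g * (1 + (1 + Real.log n)) := by gcongr
    change Real.log (h i) - Real.log (h j) ≤ _ at h3
    linarith
  rw [← Real.exp_log (hpos i), ← Real.exp_log (hpos j), ← Real.exp_add]
  exact Real.exp_le_exp.2 h5

end RatioBound

section Threshold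

variable {ℓ n : ℕ}

/-- A bound for the entries of a size-reduced unitriangular matrix and of its inverse. -/
noncomputable def entryBound (ℓ n : ℕ) : ℝ := (parDiam ℓ * n) ^ Nat.clog 2 n

/-- A bound for the decrease of the diagonal entries of a reduced basis. -/
noncomputable def ratioBound (ℓ n : ℕ) : ℝ :=
  Real.exp (2 * Real.log (16 * n * parDiam ℓ ^ 2) * (2 + Real.log n))

/-- A bound for the distortion between a hermitian form and the diagonal of its Gram matrix in a
reduced basis. -/
noncomputable def distortionBound (ℓ n : ℕ) : ℝ :=
  n ^ 3 * entryBound ℓ n ^ 4 * ratioBound ℓ n ^ 2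

/-- In a reduced basis a hermitian form dominates the diagonal of its Gram matrix. -/
lemma exists_reduced_basis (hℓ : 0 < ℓ) [IsPrincipalIdealRing (intO ℓ)] (hn : 0 < n)
    {M : Matrix (Fin n) (Fin n) ℂ} (hM : M.PosDef) :
    ∃ G G' : Matrix (Fin n) (Fin n) ℂ, (∀ i j, G i j ∈ intO ℓ) ∧ (∀ i j, G' i j ∈ intO ℓ) ∧
      G * G' = 1 ∧ ∀ x, ∑ i, ((Gᴴ * M * G) i i).re * Complex.normSq (x i) ≤
        distortionBound ℓ n * hermVal (Gᴴ * M * G) x := by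
  obtain ⟨G₁, G₁', U, h, hG₁, hG₁', h₁, hU, hpos, hval, hred⟩ :=
    exists_korkineZolotarev_reduction hℓ M hM
  obtain ⟨G₂, G₂', V, hG₂, hG₂', h₂, hW, hV, hVW, hWle, hVle⟩ :=
    UpperUnitri.exists_seysen_reduction hℓ hn (Nat.clog 2 n) (Nat.le_pow_clog one_lt_two n)
      le_rfl hU
  refine ⟨G₁ * G₂, G₂' * G₁', mul_apply_mem_intO hG₁ hG₂, mul_apply_mem_intO hG₂' hG₁', ?_, ?_⟩
  · rw [Matrix.mul_assoc, ← Matrix.mul_assoc G₂, h₂, Matrix.one_mul, h₁]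
  set W := U * G₂
  set q := entryBound ℓ n
  set Q := ratioBound ℓ n
  have hQ : 0 < Q := Real.exp_pos _
  have hvalW : ∀ x, hermVal ((G₁ * G₂)ᴴ * M * (G₁ * G₂)) x =
      ∑ k, h k * Complex.normSq ((W *ᵥ x) k) := fun x => by
    rw [hermVal_conj, ← Matrix.mulVec_mulVec, hval, Matrix.mulVec_mulVec]
  have hent : ∀ {T : Matrix (Fin n) (Fin n) ℂ}, UpperUnitri T → (∀ i j, ‖T i j‖ ≤ q) →
      ∀ i j, h i * Complex.normSq (T i j) ≤ q ^ 2 * Q * h j := by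
    intro T hT hTq i j
    have hj := hpos j
    rcases le_or_gt i j with hij | hij
    · have h1 : Complex.normSq (T i j) ≤ q ^ 2 := by
        rw [Complex.normSq_eq_norm_sq]
        exact pow_le_pow_left₀ (norm_nonneg _) (hTq i j) 2
      calc _ ≤ Q * h j * q ^ 2 := mul_le_mul (hU.le_exp_mul_of_reduced hℓ hpos hred hij) h1
            (Complex.normSq_nonneg _) (by positivity)
        _ = _ := by ring
    · rw [hT.lower _ _ hij, map_zero, mul_zero]
      positivity
  have hdiag : ∀ i, (((G₁ * G₂)ᴴ * M * (G₁ * G₂)) i i).re ≤ n * q ^ 2 * Q * h i := by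
    intro i
    rw [← hermVal_single, hvalW]
    calc _ ≤ ∑ _k : Fin n, q ^ 2 * Q * h i := Finset.sum_le_sum fun k _ => by
          simpa using hent hW hWle k i
      _ = _ := by simp; ring
  intro x
  set D := hermVal ((G₁ * G₂)ᴴ * M * (G₁ * G₂)) x
  have hx : ∀ i, h i * Complex.normSq (x i) ≤ n * q ^ 2 * Q * D := by
    intro i
    have e : x i = ∑ k, V i k * (W *ᵥ x) k := by
      have : V *ᵥ (W *ᵥ x) = x := by rw [Matrix.mulVec_mulVec, hVW, Matrix.one_mulVec]
      exact (congrFun this i).symm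
    have h3 : Complex.normSq (x i) ≤
        n * ∑ k, Complex.normSq (V i k) * Complex.normSq ((W *ᵥ x) k) := by
      rw [e, Complex.normSq_eq_norm_sq]
      calc _ ≤ (∑ k, ‖V i k * (W *ᵥ x) k‖) ^ 2 :=
            pow_le_pow_left₀ (norm_nonneg _) (norm_sum_le _ _) 2
        _ ≤ n * ∑ k, ‖V i k * (W *ᵥ x) k‖ ^ 2 := by
            simpa using sq_sum_le_card_mul_sum_sq (s := Finset.univ)
              (f := fun k => ‖V i k * (W *ᵥ x) k‖)
        _ = _ := by simp only [← Complex.normSq_eq_norm_sq, map_mul]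
    calc _ ≤ h i * (n * ∑ k, Complex.normSq (V i k) * Complex.normSq ((W *ᵥ x) k)) :=
          mul_le_mul_of_nonneg_left h3 (hpos i).le
      _ = n * ∑ k, (h i * Complex.normSq (V i k)) * Complex.normSq ((W *ᵥ x) k) := by
          rw [mul_left_comm, Finset.mul_sum]
          simp only [mul_assoc]
      _ ≤ n * ∑ k, (q ^ 2 * Q * h k) * Complex.normSq ((W *ᵥ x) k) := by
          exact mul_le_mul_of_nonneg_left (Finset.sum_le_sum fun k _ =>
            mul_le_mul_of_nonneg_right (hent hV hVle i k) (Complex.normSq_nonneg _))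
            (Nat.cast_nonneg n)
      _ = n * q ^ 2 * Q * ∑ k, h k * Complex.normSq ((W *ᵥ x) k) := by
          simp only [Finset.mul_sum]
          exact Finset.sum_congr rfl fun k _ => by ring
      _ = _ := by rw [← hvalW]
  calc _ ≤ ∑ _i : Fin n, n * q ^ 2 * Q * (n * q ^ 2 * Q * D) := Finset.sum_le_sum fun i _ => by
        calc _ ≤ n * q ^ 2 * Q * h i * Complex.normSq (x i) :=
              mul_le_mul_of_nonneg_right (hdiag i) (Complex.normSq_nonneg _)
          _ = n * q ^ 2 * Q * (h i * Complex.normSq (x i)) := by ring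
          _ ≤ _ := by
              have := hx i
              gcongr
    _ = distortionBound ℓ n * D := by
        simp only [Finset.sum_const, Finset.card_univ, Fintype.card_fin, nsmul_eq_mul,
          distortionBound]
        ring

lemma one_le_entryBound (hn : 0 < n) : 1 ≤ entryBound ℓ n :=
  one_le_pow₀ (one_le_mul_of_one_le_of_one_le (one_le_parDiam ℓ) (by exact_mod_cast hn))

lemma one_le_ratioBound (hn : 0 < n) : 1 ≤ ratioBound ℓ n := by
  have hc := one_le_parDiam ℓ
  have hnR : (1 : ℝ) ≤ n := by exact_mod_cast hn
  refine Real.one_le_exp (mul_nonneg (mul_nonneg zero_le_two (Real.log_nonneg ?_)) ?_)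
  · exact one_le_mul_of_one_le_of_one_le (by linarith) (one_le_pow₀ hc)
  · linarith [Real.log_nonneg hnR]

lemma one_le_distortionBound (hn : 0 < n) : 1 ≤ distortionBound ℓ n :=
  one_le_mul_of_one_le_of_one_le (one_le_mul_of_one_le_of_one_le
    (one_le_pow₀ (by exact_mod_cast hn)) (one_le_pow₀ (one_le_entryBound hn)))
    (one_le_pow₀ (one_le_ratioBound hn))

/-- A multiple of a positive definite integral hermitian form by a sufficiently large integer is a
sum of norms. -/
lemma nsmul_mem_sumsOfNorms (hℓ : 0 < ℓ) [IsPrincipalIdealRing (intO ℓ)] (hn : 0 < n)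
    {M : Matrix (Fin n) (Fin n) ℂ} (hMint : ∀ i j, M i j ∈ intO ℓ) (hM : M.PosDef) {s : ℕ}
    (hs : (36 * parDiam ℓ ^ 4 * distortionBound ℓ n) ^ 2 * n ^ 3 ≤ s) :
    (s : ℂ) • M ∈ sumsOfNorms ℓ n := by
  obtain ⟨G, G', hG, hG', h, hdom⟩ := exists_reduced_basis hℓ hn hM
  have hM' := hM.conj h
  have hM'int : ∀ i j, (Gᴴ * M * G) i j ∈ intO ℓ :=
    mul_apply_mem_intO (mul_apply_mem_intO (fun i j => star_mem_intO (hG j i)) hMint) hG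
  have hμ : ∀ i, ∃ m : ℕ, 0 < m ∧ (Gᴴ * M * G) i i = m := by
    intro i
    obtain ⟨a, ha⟩ := intO_eq_intCast hℓ (hM'int i i) (hM'.1.im_apply_self_eq_zero i)
    have hpos : 0 < ((Gᴴ * M * G) i i).re := by
      rw [← hermVal_single]
      exact hermVal_pos hM' (by simp)
    rw [ha, Complex.intCast_re] at hpos
    lift a to ℕ using (by exact_mod_cast hpos.le)
    exact ⟨a, by exact_mod_cast hpos, by simpa using ha⟩
  choose μ hμ hdiag using hμ
  have hmem := nsmul_mem_sumsOfNorms_of_dominates hℓ hM'int hM'.1 hμ hdiag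
    (one_le_distortionBound hn) (fun x => by simpa [hdiag, hermVal] using hdom x) hs
  have e : (s : ℂ) • M = G'ᴴ * ((s : ℂ) • (Gᴴ * M * G)) * G' := by
    have e' : G'ᴴ * (Gᴴ * M * G) * G' = (G * G')ᴴ * M * (G * G') := by
      simp only [Matrix.conjTranspose_mul, Matrix.mul_assoc]
    rw [Matrix.mul_smul, Matrix.smul_mul, e', h]
    simp
  rw [e]
  exact conj_mem_sumsOfNorms hmem hG'

lemma natCast_clog_two_le (hn : 0 < n) : (Nat.clog 2 n : ℝ) ≤ 2 * (1 + Real.log n) := by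
  have hnR : (0 : ℝ) < n := by exact_mod_cast hn
  have h0 : 0 ≤ Real.log n := Real.log_natCast_nonneg n
  rcases Nat.lt_or_ge 1 n with h1 | h1
  · have h2 : 2 ^ (Nat.clog 2 n).pred < n := Nat.pow_pred_clog_lt_self one_lt_two h1
    have h3 : (2 : ℝ) ^ (Nat.clog 2 n).pred ≤ n := by exact_mod_cast h2.le
    have h4 := Real.log_le_log (by positivity) h3
    rw [Real.log_pow] at h4
    have h5 : (Nat.clog 2 n : ℝ) ≤ (Nat.clog 2 n).pred + 1 := by
      exact_mod_cast Nat.le_succ_of_pred_le le_rfl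
    have h6 := Real.log_two_gt_d9
    have h7 : (0 : ℝ) ≤ (Nat.clog 2 n).pred := by positivity
    nlinarith
  · rw [Nat.clog_of_right_le_one h1]
    push_cast
    linarith

lemma exists_threshold_le_exp (ℓ : ℕ) : ∃ A > 0, ∀ n : ℕ, 0 < n →
    (36 * parDiam ℓ ^ 4 * distortionBound ℓ n) ^ 2 * n ^ 3 ≤
      Real.exp (A * (1 + Real.log n) ^ 2) := by
  set c := parDiam ℓ
  have hc : 1 ≤ c := one_le_parDiam ℓ
  have hlc := Real.log_nonneg hc
  have hlc' : 0 ≤ Real.log (36 * c ^ 4) := by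
    have := one_le_pow₀ hc (n := 4)
    exact Real.log_nonneg (by linarith)
  have hl16 : 0 ≤ Real.log 16 := Real.log_nonneg (by norm_num)
  refine ⟨2 * Real.log (36 * c ^ 4) + 6 + 16 * (1 + Real.log c) +
    16 * (Real.log 16 + 2 * Real.log c + 1) + 3, by positivity, fun n hn => ?_⟩
  have hnR : (1 : ℝ) ≤ n := by exact_mod_cast hn
  have hn0 : (n : ℝ) ≠ 0 := by positivity
  have hc0 : c ≠ 0 := by positivity
  have hq := (zero_lt_one.trans_le (one_le_entryBound (ℓ := ℓ) hn)).ne'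
  have hQ := (zero_lt_one.trans_le (one_le_ratioBound (ℓ := ℓ) hn)).ne'
  have hX := (zero_lt_one.trans_le (one_le_distortionBound (ℓ := ℓ) hn)).ne'
  have hlogX : Real.log (distortionBound ℓ n) = 3 * Real.log n +
      4 * (Nat.clog 2 n * (Real.log c + Real.log n)) +
      2 * (2 * (Real.log 16 + Real.log n + 2 * Real.log c) * (2 + Real.log n)) := by
    rw [distortionBound, Real.log_mul (mul_ne_zero (pow_ne_zero _ hn0) (pow_ne_zero _ hq))
      (pow_ne_zero _ hQ), Real.log_mul (pow_ne_zero _ hn0) (pow_ne_zero _ hq), Real.log_pow,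
      Real.log_pow, Real.log_pow, entryBound, ratioBound, Real.log_exp, Real.log_pow,
      Real.log_mul hc0 hn0, Real.log_mul (by positivity) (by positivity),
      Real.log_mul (by norm_num) hn0, Real.log_pow]
    push_cast
    ring
  rw [← Real.log_le_iff_le_exp (by positivity), Real.log_mul (by positivity) (by positivity),
    Real.log_pow, Real.log_pow, Real.log_mul (by positivity) hX, hlogX]
  push_cast
  have hK := natCast_clog_two_le hn
  set t := Real.log n
  have ht : 0 ≤ t := Real.log_natCast_nonneg n
  have h1 : Nat.clog 2 n * (Real.log c + t) ≤ 2 * (1 + t) * ((1 + Real.log c) * (1 + t)) := by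
    gcongr
    nlinarith
  have h2 : (Real.log 16 + t + 2 * Real.log c) * (2 + t) ≤
      ((Real.log 16 + 2 * Real.log c + 1) * (1 + t)) * (2 * (1 + t)) := by
    gcongr
    · nlinarith
    · linarith
  have h3 : Real.log (36 * c ^ 4) ≤ Real.log (36 * c ^ 4) * (1 + t) ^ 2 :=
    le_mul_of_one_le_right hlc' (one_le_pow₀ (by linarith))
  nlinarith

lemma eventually_mul_sq_log_le (A : ℝ) {k : ℝ} (hk : 0 < k) :
    ∀ᶠ L : ℝ in Filter.atTop, A * (1 + 2 * Real.log (L / k)) ^ 2 ≤ L := by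
  have hO : (fun L : ℝ => 1 + 2 * (Real.log L - Real.log k)) =O[Filter.atTop] Real.log := by
    have hc (c : ℝ) : (fun _ : ℝ => c) =O[Filter.atTop] Real.log :=
      Real.isLittleO_const_log_atTop.isBigO
    exact (hc 1).add (((Asymptotics.isBigO_refl _ _).sub (hc _)).const_mul_left 2)
  have ho := ((hO.pow 2).trans_isLittleO Real.isLittleO_pow_log_id_atTop).const_mul_left A
  filter_upwards [ho.def zero_lt_one, Filter.eventually_gt_atTop 0] with L hL hL0
  rw [Real.log_div hL0.ne' hk.ne']
  rw [one_mul, id, Real.norm_of_nonneg hL0.le] at hL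
  exact (Real.le_norm_self _).trans hL

end Threshold

/-- Suppose `𝓞` is a principal ideal domain.  For every `ε ∈ (0,1)` there exists `s₀` such
that for every integer `s ≥ s₀`: if `M` is an `n`-variable positive definite integral
hermitian form over `𝓞` such that `s·M` is not represented by any `I_r`, then
`n ≥ (1−ε)·(ln s/k_E)²` with `k_E = (4+4√2)√β_E`.  Equivalently,
`φ*_𝓞(s) ≥ (ln s/k_E)²·(1+o(1))`. -/
theorem phiO_lower_bound (ℓ : ℕ) (hsf : Squarefree ℓ) (hpos : 0 < ℓ)
    (hPID : IsPrincipalIdealRing (intO ℓ)) :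
    ∀ ε : ℝ, 0 < ε → ε < 1 → ∃ s₀ : ℕ, ∀ s : ℕ, s₀ ≤ s →
      ∀ n : ℕ, ∀ M : Matrix (Fin n) (Fin n) ℂ, (∀ i j, M i j ∈ intO ℓ) → M.PosDef →
        (¬ ∃ r : ℕ, 0 < r ∧ RepByNorms ℓ n r ((s : ℂ) • M)) →
        (1 - ε) * (Real.log s / ((4 + 4 * Real.sqrt 2) * Real.sqrt (betaE ℓ))) ^ 2 ≤ (n : ℝ) := by
  intro ε hε _
  have hk : 0 < (4 + 4 * Real.sqrt 2) * Real.sqrt (betaE ℓ) := by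
    have hℓR : (0 : ℝ) < ℓ := by exact_mod_cast hpos
    have hβ : 0 < betaE ℓ := by
      unfold betaE
      split_ifs <;> positivity
    positivity
  set k := (4 + 4 * Real.sqrt 2) * Real.sqrt (betaE ℓ)
  obtain ⟨A, hA, hthr⟩ := exists_threshold_le_exp ℓ
  obtain ⟨s₀, hs₀⟩ := Filter.eventually_atTop.1 ((Real.tendsto_log_atTop.comp
    tendsto_natCast_atTop_atTop).eventually (eventually_mul_sq_log_le A hk))
  refine ⟨max s₀ 1, fun s hs n M hMint hM hrep => ?_⟩
  by_contra! hlt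
  refine hrep (exists_pos_rep_of_mem_sumsOfNorms ?_)
  rcases Nat.eq_zero_or_pos n with rfl | hn
  · rw [Subsingleton.elim ((s : ℂ) • M) 0]
    exact zero_mem _
  have hnR : (0 : ℝ) < n := by exact_mod_cast hn
  have hs0 : (0 : ℝ) < s := by exact_mod_cast (le_max_right _ _).trans hs
  have hn_le : (n : ℝ) ≤ (Real.log s / k) ^ 2 :=
    hlt.le.trans (mul_le_of_le_one_left (sq_nonneg _) (by linarith))
  have hlog : Real.log n ≤ 2 * Real.log (Real.log s / k) := by
    simpa [Real.log_pow] using Real.log_le_log hnR hn_le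
  refine nsmul_mem_sumsOfNorms hpos hn hMint hM ((hthr n hn).trans ?_)
  rw [← Real.le_log_iff_exp_le hs0]
  refine le_trans ?_ (hs₀ s ((le_max_left _ _).trans hs))
  have := Real.log_natCast_nonneg n
  simp only [Function.comp_apply]
  gcongr
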